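/- arXiv:2002.06630 — 3 statements merged into one kernel-verified Lean document; each statement's English description precedes it below -/
import Mathlib

section
/- Let M be a matroid on a finite ground set V with rank function ρ_M and ρ_M(V) = m ≥ 1, and let {Z_K : K ∈ K(M)} be a family of simplicial complexes on a common finite vertex set, each containing the empty simplex, indexed by the proper flats of M and satisfying Z_K ∪ Z_{K'} = Z_{K ∩ K'} for all K, K' ∈ K(M). If ⋂_{K ∈ K(M)} Z_K = {∅}, then there exist an integer 0 ≤ p ≤ m−1 and a flat K ∈ K(M) with ρ_M(K) = m−p−1 such that h̃_{p−1}(Z_K;F) ≠ 0. -/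
open Finset

/-- An abstract simplicial complex on the vertex type `V`: a set of finite subsets
("simplices") closed under taking subsets. -/
def IsComplex {V : Type*} (X : Set (Finset V)) : Prop :=
  ∀ σ ∈ X, ∀ τ, τ ⊆ σ → τ ∈ X

variable {V : Type*}

/-- The induced subcomplex `X[S] = {σ ∈ X : σ ⊆ S}`. -/
def induce (X : Set (Finset V)) (S : Finset V) : Set (Finset V) :=
  {σ | σ ∈ X ∧ σ ⊆ S}

/-- The link `lk(X,τ) = {σ : σ ∪ τ ∈ X, σ ∩ τ = ∅}`; it is the void complex if `τ ∉ X`. -/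
def link [DecidableEq V] (X : Set (Finset V)) (τ : Finset V) : Set (Finset V) :=
  {σ | σ ∪ τ ∈ X ∧ Disjoint σ τ}

/-- The star `str(X,τ) = {σ ∈ X : σ ∪ τ ∈ X}`. -/
def star [DecidableEq V] (X : Set (Finset V)) (τ : Finset V) : Set (Finset V) :=
  {σ | σ ∈ X ∧ σ ∪ τ ∈ X}

/-- The Alexander dual `X^∨ = {A ⊆ V : V \ A ∉ X}` of a complex on the finite vertex set
`V`. -/
def alexDual [Fintype V] [DecidableEq V] (X : Set (Finset V)) : Set (Finset V) :=
  {A | Aᶜ ∉ X}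

section Homology

variable (F : Type) [Field F]

/-- The faces of `X` of cardinality `n` (i.e. of dimension `n-1`). -/
def Face (X : Set (Finset V)) (n : ℕ) : Type _ :=
  {σ : Finset V // σ ∈ X ∧ σ.card = n}

/-- Simplicial chains in dimension `n-1`: formal `F`-linear combinations of faces of
cardinality `n`.  Since the empty face spans the degree `n = 0` part, this yields the
*augmented* simplicial chain complex of `X`. -/
def SChain (X : Set (Finset V)) (n : ℕ) : Type _ := Face X n →₀ F

noncomputable instance (X : Set (Finset V)) (n : ℕ) : AddCommGroup (SChain F X n) :=
  Finsupp.instAddCommGroup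

noncomputable instance (X : Set (Finset V)) (n : ℕ) : Module F (SChain F X n) :=
  Finsupp.module (Face X n) F

variable [LinearOrder V]

open Classical in
/-- The boundary of a face of cardinality `n+1`: the alternating sum of its codimension-one
subfaces, with signs determined by the linear order on the vertices. -/
noncomputable def bdryElem (X : Set (Finset V)) (n : ℕ) (σ : Face X (n+1)) :
    SChain F X n :=
  ∑ x ∈ σ.1.attach,
    if h : σ.1.erase ↑x ∈ X then
      ((-1 : F) ^ ((σ.1.filter (fun y => y < (x : V))).card)) •
        (Finsupp.single (⟨σ.1.erase ↑x, h, by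
          rw [Finset.card_erase_of_mem x.2, σ.2.2]; rfl⟩ : Face X n) 1 : SChain F X n)
    else 0

/-- The simplicial boundary map (in degree `0` it is the augmentation `C_0 → C_{-1} ≅ F`
encoded by `scyc`). -/
noncomputable def sbdry (X : Set (Finset V)) (n : ℕ) :
    SChain F X (n+1) →ₗ[F] SChain F X n :=
  Finsupp.lsum F fun σ => LinearMap.toSpanSingleton F (SChain F X n) (bdryElem F X n σ)

/-- The cycles of the augmented simplicial chain complex. -/
noncomputable def scyc (X : Set (Finset V)) : (n : ℕ) → Submodule F (SChain F X n)
  | 0 => ⊤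
  | (n+1) => LinearMap.ker (sbdry F X n)

/-- `RH F X n` is the reduced simplicial homology `h̃_{n-1}(X; F)` of `X` with coefficients
in `F` (faces of cardinality `n` have dimension `n-1`). -/
abbrev RH (X : Set (Finset V)) (n : ℕ) : Type _ :=
  scyc F X n ⧸ Submodule.comap (scyc F X n).subtype (LinearMap.range (sbdry F X n))

/-- `X` is `d`-Leray over `F`: every induced subcomplex has vanishing reduced homology in
all dimensions `i ≥ d`. -/
def IsLeray (d : ℕ) (X : Set (Finset V)) : Prop :=
  ∀ S : Finset V, ∀ i : ℕ, d ≤ i → Subsingleton (RH F (induce X S) (i+1))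

end Homology


/-- The rank `ρ_M(S)` of a set `S` in a matroid `M`: the maximal cardinality of an
independent subset of `S`. -/
noncomputable def matroidRank {V : Type*} (M : Matroid V) (S : Set V) : ℕ :=
  sSup {n | ∃ I : Finset V, ↑I ⊆ S ∧ M.Indep ↑I ∧ I.card = n}

/-- The matroid `M`, identified with the simplicial complex of its independent sets. -/
def indepComplex {V : Type*} (M : Matroid V) : Set (Finset V) :=
  {σ | M.Indep ↑σ}

/-- The proper flats `K(M)` of a matroid: flats `K ≠ M.E`, ordered by inclusion. -/
def ProperFlats {V : Type*} (M : Matroid V) : Set (Set V) :=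
  {K | M.IsFlat K ∧ K ≠ M.E}

section AmbientChains

variable {W : Type*} (F : Type) [Field F]

/-- The chains of `X` spanned by the faces of cardinality `n`, inside the chains of the full
simplex. -/
noncomputable def ambientChains (X : Set (Finset W)) (n : ℕ) : Submodule F (Finset W →₀ F) :=
  Finsupp.supported F F {σ | σ ∈ X ∧ σ.card = n}

lemma ambientChains_mono {X Y : Set (Finset W)} (h : X ⊆ Y) (n : ℕ) :
    ambientChains F X n ≤ ambientChains F Y n :=
  Finsupp.supported_mono fun _ hσ => ⟨h hσ.1, hσ.2⟩

lemma ambientChains_inter (X Y : Set (Finset W)) (n : ℕ) :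
    ambientChains F (X ∩ Y) n = ambientChains F X n ⊓ ambientChains F Y n := by
  rw [ambientChains, ambientChains, ambientChains, ← Finsupp.supported_inter]
  congr 1
  ext σ
  simp only [Set.mem_ofPred_eq, Set.mem_inter_iff]
  tauto

lemma ambientChains_union (X Y : Set (Finset W)) (n : ℕ) :
    ambientChains F (X ∪ Y) n = ambientChains F X n ⊔ ambientChains F Y n := by
  rw [ambientChains, ambientChains, ambientChains, ← Finsupp.supported_union]
  congr 1
  ext σ
  simp only [Set.mem_ofPred_eq, Set.mem_union]
  tauto

/-- The chains of `X` as chains of the full simplex. -/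
noncomputable def chainIncl (X : Set (Finset W)) (n : ℕ) :
    SChain F X n →ₗ[F] (Finset W →₀ F) :=
  Finsupp.lmapDomain F F (fun σ : Face X n => σ.1)

lemma chainIncl_single (X : Set (Finset W)) (n : ℕ) (σ : Face X n) (a : F) :
    chainIncl F X n (Finsupp.single σ a) = Finsupp.single σ.1 a :=
  Finsupp.mapDomain_single

lemma chainIncl_injective (X : Set (Finset W)) (n : ℕ) : Function.Injective (chainIncl F X n) :=
  Finsupp.mapDomain_injective Subtype.val_injective

lemma range_chainIncl (X : Set (Finset W)) (n : ℕ) :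
    LinearMap.range (chainIncl F X n) = ambientChains F X n := by
  have h := Finsupp.lmapDomain_supported (M := F) (R := F) (fun σ : Face X n => σ.1) Set.univ
  rw [Finsupp.supported_univ, Submodule.map_top] at h
  refine h.trans ?_
  rw [ambientChains]
  congr 1
  ext σ
  exact ⟨fun ⟨τ, _, h⟩ => h ▸ τ.2, fun h => ⟨⟨σ, h⟩, trivial, rfl⟩⟩

variable [LinearOrder W]

/-- The simplicial boundary operator on the chains of the full simplex on `W`, all dimensions
taken together. -/
noncomputable def ambientBdry : (Finset W →₀ F) →ₗ[F] (Finset W →₀ F) :=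
  Finsupp.lsum F fun σ => LinearMap.toSpanSingleton F (Finset W →₀ F)
    (∑ x ∈ σ, ((-1 : F) ^ (σ.filter (fun y => y < x)).card) • Finsupp.single (σ.erase x) 1)

lemma ambientBdry_single (σ : Finset W) (c : F) :
    ambientBdry F (Finsupp.single σ c) = c • ∑ x ∈ σ,
      ((-1 : F) ^ (σ.filter (fun y => y < x)).card) • Finsupp.single (σ.erase x) (1 : F) := by
  simp [ambientBdry]

lemma neg_one_pow_erase_add_swap {σ : Finset W} {x y : W} (hx : x ∈ σ) (hxy : x < y) :
    (-1 : F) ^ (σ.filter (fun z => z < x)).card *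
        (-1 : F) ^ ((σ.erase x).filter (fun z => z < y)).card +
      (-1 : F) ^ (σ.filter (fun z => z < y)).card *
        (-1 : F) ^ ((σ.erase y).filter (fun z => z < x)).card = 0 := by
  have h₁ : (σ.erase y).filter (fun z => z < x) = σ.filter (fun z => z < x) := by
    ext z
    simp only [mem_filter, mem_erase]
    exact ⟨fun h => ⟨h.1.2, h.2⟩, fun h => ⟨⟨(h.2.trans hxy).ne, h.1⟩, h.2⟩⟩
  have h₂ : (σ.filter (fun z => z < y)).card =
      ((σ.erase x).filter (fun z => z < y)).card + 1 := by
    rw [filter_erase, card_erase_add_one (mem_filter.2 ⟨hx, hxy⟩)]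
  rw [h₁, h₂]
  ring

lemma ambientBdry_ambientBdry (c : Finset W →₀ F) : ambientBdry F (ambientBdry F c) = 0 := by
  induction c using Finsupp.induction_linear with
  | zero => simp
  | add f g hf hg => simp [hf, hg]
  | single σ a =>
    rw [ambientBdry_single, map_smul, map_sum]
    simp only [map_smul, ambientBdry_single, smul_sum, smul_smul]
    rw [sum_sigma']
    refine sum_involution (fun p _ => ⟨p.2, p.1⟩) ?_ ?_ ?_ ?_
    · rintro ⟨x, y⟩ h
      simp only [mem_sigma, mem_erase] at h
      obtain ⟨hx, hyx, hy⟩ := h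
      rw [erase_right_comm, ← add_smul, one_mul, one_mul, ← mul_add]
      rcases lt_or_gt_of_ne hyx with h | h
      · rw [add_comm, neg_one_pow_erase_add_swap F hy h]; simp
      · rw [neg_one_pow_erase_add_swap F hx h]; simp
    · rintro ⟨x, y⟩ h - heq
      simp only [mem_sigma, mem_erase] at h
      simp only [Sigma.mk.injEq] at heq
      exact h.2.1 heq.1
    · rintro ⟨x, y⟩ h
      simp only [mem_sigma, mem_erase] at h ⊢
      exact ⟨h.2.2, h.2.1.symm, h.1⟩
    · rintro ⟨x, y⟩ h
      rfl

lemma ambientBdry_mem {X : Set (Finset W)} (hX : IsComplex X) {n : ℕ} {c : Finset W →₀ F}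
    (hc : c ∈ ambientChains F X (n + 1)) : ambientBdry F c ∈ ambientChains F X n := by
  rw [← Finsupp.sum_single c, Finsupp.sum, map_sum]
  refine Submodule.sum_mem _ fun σ hσ => ?_
  obtain ⟨hσX, hσn⟩ := hc hσ
  rw [ambientBdry_single]
  refine Submodule.smul_mem _ _ (Submodule.sum_mem _ fun x hx => Submodule.smul_mem _ _ ?_)
  refine Finsupp.single_mem_supported F 1 ⟨hX σ hσX _ (erase_subset _ _), ?_⟩
  rw [card_erase_of_mem hx, hσn, Nat.add_sub_cancel]

/-- Exactness in cardinality `n` of the augmented chain complex of `X`, phrased inside the chains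
of the full simplex. -/
def IsExactAt (X : Set (Finset W)) (n : ℕ) : Prop :=
  ∀ z ∈ ambientChains F X n, ambientBdry F z = 0 →
    ∃ c ∈ ambientChains F X (n + 1), ambientBdry F c = z

/-- The part of the Mayer–Vietoris sequence around the homology of an intersection. -/
lemma IsExactAt.inter {X Y : Set (Finset W)} (hX : IsComplex X) (hY : IsComplex Y) {n : ℕ}
    (hXn : IsExactAt F X n) (hYn : IsExactAt F Y n) (hXY : IsExactAt F (X ∪ Y) (n + 1)) :
    IsExactAt F (X ∩ Y) n := by
  intro z hz hz0
  rw [ambientChains_inter] at hz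
  obtain ⟨a, ha, haz⟩ := hXn z hz.1 hz0
  obtain ⟨b, hb, hbz⟩ := hYn z hz.2 hz0
  obtain ⟨c, hc, hcab⟩ := hXY (a - b)
    (sub_mem (ambientChains_mono F Set.subset_union_left _ ha)
      (ambientChains_mono F Set.subset_union_right _ hb))
    (by rw [map_sub, haz, hbz, sub_self])
  rw [ambientChains_union] at hc
  obtain ⟨u, hu, v, hv, rfl⟩ := Submodule.mem_sup.1 hc
  have heq : a - ambientBdry F u = b + ambientBdry F v := by
    rw [map_add] at hcab
    rw [sub_eq_iff_eq_add, add_right_comm, add_assoc, hcab]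
    abel
  refine ⟨a - ambientBdry F u, ?_, ?_⟩
  · rw [ambientChains_inter]
    refine ⟨sub_mem ha (ambientBdry_mem F hX hu), ?_⟩
    rw [heq]
    exact add_mem hb (ambientBdry_mem F hY hv)
  · rw [map_sub, haz, ambientBdry_ambientBdry, sub_zero]

lemma not_isExactAt_singleton_empty : ¬ IsExactAt F ({∅} : Set (Finset W)) 0 := by
  intro h
  obtain ⟨c, hc, hcz⟩ := h (Finsupp.single ∅ 1)
    (Finsupp.single_mem_supported F 1 ⟨rfl, card_empty⟩) (by simp [ambientBdry_single])
  have hc0 : c = 0 := by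
    ext σ
    by_contra hne
    obtain ⟨hσ, hcard⟩ := hc (Finsupp.mem_support_iff.2 hne)
    rw [Set.mem_singleton_iff.1 hσ] at hcard
    simp at hcard
  rw [hc0, map_zero] at hcz
  exact one_ne_zero (Finsupp.single_eq_zero.1 hcz.symm)

lemma sbdry_single (X : Set (Finset W)) (n : ℕ) (σ : Face X (n + 1)) (a : F) :
    sbdry F X n (Finsupp.single σ a) = a • bdryElem F X n σ := by
  refine (Finsupp.lsum_single F _ σ a).trans ?_
  rw [LinearMap.toSpanSingleton_apply]

lemma chainIncl_bdryElem {X : Set (Finset W)} (hX : IsComplex X) (n : ℕ) (σ : Face X (n + 1)) :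
    chainIncl F X n (bdryElem F X n σ) = ambientBdry F (Finsupp.single σ.1 1) := by
  rw [ambientBdry_single, one_smul, bdryElem, map_sum, ← sum_attach σ.1]
  refine sum_congr rfl fun x _ => ?_
  have hx : σ.1.erase x ∈ X := hX σ.1 σ.2.1 _ (erase_subset _ _)
  refine (congrArg (chainIncl F X n) (dif_pos hx)).trans ?_
  exact (map_smul _ _ _).trans (congrArg _ (chainIncl_single F X n _ _))

lemma chainIncl_sbdry {X : Set (Finset W)} (hX : IsComplex X) (n : ℕ) (c : SChain F X (n + 1)) :
    chainIncl F X n (sbdry F X n c) = ambientBdry F (chainIncl F X (n + 1) c) := by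
  suffices h : (chainIncl F X n).comp (sbdry F X n) =
      (ambientBdry F).comp (chainIncl F X (n + 1)) from LinearMap.congr_fun h c
  refine Finsupp.lhom_ext fun σ a => ?_
  refine (congrArg (chainIncl F X n) (sbdry_single F X n σ a)).trans ?_
  refine Eq.trans ?_ (congrArg (ambientBdry F) (chainIncl_single F X (n + 1) σ a)).symm
  rw [map_smul, chainIncl_bdryElem F hX, ambientBdry_single, ambientBdry_single, one_smul]

lemma isExactAt_of_subsingleton_RH {X : Set (Finset W)} (hX : IsComplex X) {n : ℕ}
    (h : Subsingleton (RH F X n)) : IsExactAt F X n := by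
  intro z hz hz0
  rw [← range_chainIncl] at hz
  obtain ⟨z, rfl⟩ := hz
  have hcyc : z ∈ scyc F X n := by
    cases n with
    | zero => exact Submodule.mem_top
    | succ n =>
      refine LinearMap.mem_ker.2 (chainIncl_injective F X n ?_)
      rw [chainIncl_sbdry F hX, hz0, map_zero]
  rw [Submodule.Quotient.subsingleton_iff] at h
  obtain ⟨c, hc⟩ : z ∈ LinearMap.range (sbdry F X n) :=
    Submodule.mem_comap.1 (h ▸ Submodule.mem_top : (⟨z, hcyc⟩ : scyc F X n) ∈ _)
  refine ⟨chainIncl F X (n + 1) c, ?_, ?_⟩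
  · rw [← range_chainIncl]
    exact LinearMap.mem_range_self _ c
  · rw [← chainIncl_sbdry F hX, hc]

end AmbientChains

section Flats

variable {V : Type*} {M : Matroid V}

lemma isFlat_inter {K K' : Set V} (hK : M.IsFlat K) (hK' : M.IsFlat K') : M.IsFlat (K ∩ K') := by
  have hsub : K ∩ K' ⊆ M.E := Set.inter_subset_left.trans hK.subset_ground
  refine M.isFlat_iff_closure_eq.2 (subset_antisymm ?_ (M.subset_closure _ hsub))
  refine Set.subset_inter ?_ ?_
  · exact (M.closure_subset_closure Set.inter_subset_left).trans hK.closure.subset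
  · exact (M.closure_subset_closure Set.inter_subset_right).trans hK'.closure.subset

lemma closure_insert_subset {K B : Set V} (hB : M.IsFlat B) (hKB : K ⊆ B) {e : V} (he : e ∈ B) :
    M.closure (insert e K) ⊆ B := by
  have h := M.closure_subset_closure (Set.insert_subset he hKB)
  rwa [hB.closure] at h

lemma subset_closure_insert {K : Set V} (hK : M.IsFlat K) {e : V} (he : e ∈ M.E) :
    insert e K ⊆ M.closure (insert e K) :=
  M.subset_closure _ (Set.insert_subset he hK.subset_ground)

variable (M) in
/-- The flats `K` of `M` with `A ⊆ K ⊂ B`. -/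
def flatsIco (A B : Set V) : Set (Set V) := {K | M.IsFlat K ∧ A ⊆ K ∧ K ⊂ B}

lemma flatsIco_subset_properFlats {A B : Set V} (hB : M.IsFlat B) :
    flatsIco M A B ⊆ ProperFlats M :=
  fun _ hK => ⟨hK.1, (hK.2.2.trans_subset hB.subset_ground).ne⟩

end Flats

section MatroidRank

variable {V : Type*} [Finite V] (M : Matroid V)

lemma matroidRank_eq_eRk (S : Set V) : (matroidRank M S : ℕ∞) = M.eRk S := by
  obtain ⟨I, hI⟩ := M.exists_isBasis' S
  have hIfin : I.Finite := Set.toFinite I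
  have hmax : IsGreatest {n | ∃ I : Finset V, ↑I ⊆ S ∧ M.Indep ↑I ∧ I.card = n} I.ncard := by
    refine ⟨⟨hIfin.toFinset, by simpa using hI.subset, by simpa using hI.indep,
      (Set.ncard_eq_toFinset_card I hIfin).symm⟩, ?_⟩
    rintro _ ⟨J, hJS, hJ, rfl⟩
    have h := hJ.encard_le_eRk_of_subset hJS
    rw [hI.eRk_eq_encard, ← hIfin.cast_ncard_eq, Set.encard_coe_eq_coe_finsetCard] at h
    exact_mod_cast h
  rw [matroidRank, hmax.csSup_eq, hI.eRk_eq_encard, hIfin.cast_ncard_eq]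

variable {M}

lemma matroidRank_mono {S T : Set V} (h : S ⊆ T) : matroidRank M S ≤ matroidRank M T := by
  have := M.eRk_mono h
  rw [← matroidRank_eq_eRk, ← matroidRank_eq_eRk] at this
  exact_mod_cast this

lemma matroidRank_closure_insert {K : Set V} (hK : M.IsFlat K) {e : V} (he : e ∈ M.E)
    (heK : e ∉ K) : matroidRank M (M.closure (insert e K)) = matroidRank M K + 1 := by
  have h := M.eRk_insert_eq_add_one (X := K) (e := e) ⟨he, by rwa [hK.closure]⟩
  rw [← M.eRk_closure_eq, ← matroidRank_eq_eRk, ← matroidRank_eq_eRk] at h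
  exact_mod_cast h

lemma matroidRank_lt_of_ssubset {K B : Set V} (hK : M.IsFlat K) (hB : M.IsFlat B) (h : K ⊂ B) :
    matroidRank M K < matroidRank M B := by
  obtain ⟨e, heB, heK⟩ := Set.exists_of_ssubset h
  rw [Nat.lt_iff_add_one_le,
    ← matroidRank_closure_insert hK (hB.subset_ground heB) heK]
  exact matroidRank_mono (closure_insert_subset hB h.subset heB)

lemma exists_corank_one_flat_superset {A B K : Set V} (hB : M.IsFlat B)
    (hK : K ∈ flatsIco M A B) :
    ∃ H ∈ flatsIco M A B, K ⊆ H ∧ matroidRank M H + 1 = matroidRank M B := by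
  obtain ⟨H, hKH, hH⟩ := (Set.toFinite (flatsIco M A B)).exists_le_maximal hK
  refine ⟨H, hH.prop, hKH, ?_⟩
  obtain ⟨hHf, hAH, hHB⟩ := hH.prop
  obtain ⟨e, heB, heH⟩ := Set.exists_of_ssubset hHB
  have heE := hB.subset_ground heB
  have hsub := subset_closure_insert hHf heE
  rw [← matroidRank_closure_insert hHf heE heH]
  congr 1
  by_contra hne
  have hmem : M.closure (insert e H) ∈ flatsIco M A B :=
    ⟨M.isFlat_closure _, hAH.trans ((Set.subset_insert e H).trans hsub),
      (closure_insert_subset hB hHB.subset heB).ssubset_of_ne hne⟩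
  exact heH (hH.le_of_ge hmem ((Set.subset_insert e H).trans hsub) (hsub (Set.mem_insert e H)))

end MatroidRank

lemma isComplex_biInter {ι W : Type*} {S : Set ι} {Z : ι → Set (Finset W)}
    (h : ∀ i ∈ S, IsComplex (Z i)) : IsComplex (⋂ i ∈ S, Z i) := by
  intro σ hσ τ hτ
  simp only [Set.mem_iInter] at hσ ⊢
  exact fun i hi => h i hi σ (hσ i hi) τ hτ

section FlatFamilies

variable {V : Type*} {M : Matroid V} {W : Type*} {Z : Set V → Set (Finset W)}

lemma subset_of_flat_subset
    (hun : ∀ K ∈ ProperFlats M, ∀ K' ∈ ProperFlats M, Z (K ∩ K') = Z K ∪ Z K')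
    {K K' : Set V} (hK : K ∈ ProperFlats M) (hK' : K' ∈ ProperFlats M) (h : K ⊆ K') :
    Z K' ⊆ Z K := by
  rw [← Set.inter_eq_left.2 h, hun K hK K' hK']
  exact Set.subset_union_right

variable [Finite V]

/-- If a set `S` of flats contains every flat of `[A, B)` through `e`, then joining the
intersection over `S` with `Z H`, where `H ∉ S` is a corank one flat avoiding `e`, gives the
intersection over `[A, H)`. -/
lemma biInter_union_corank_one
    (hun : ∀ K ∈ ProperFlats M, ∀ K' ∈ ProperFlats M, Z (K ∩ K') = Z K ∪ Z K')
    {A B H : Set V} {e : V} {S : Set (Set V)} (hB : M.IsFlat B) (heB : e ∈ B)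
    (hS : S ⊆ flatsIco M A B) (heS : flatsIco M (M.closure (insert e A)) B ⊆ S)
    (hH : H ∈ flatsIco M A B) (heH : e ∉ H) (hHS : H ∉ S)
    (hHB : matroidRank M H + 1 = matroidRank M B) :
    (⋂ K ∈ S, Z K) ∪ Z H = ⋂ K ∈ flatsIco M A H, Z K := by
  have heE := hB.subset_ground heB
  have hproper := flatsIco_subset_properFlats (A := A) hB
  ext σ
  simp only [Set.mem_union, Set.mem_iInter]
  constructor
  · rintro h K ⟨hK, hAK, hKH⟩
    have hKB : K ∈ flatsIco M A B := ⟨hK, hAK, hKH.trans hH.2.2⟩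
    rcases h with h | h
    · have hsub := subset_closure_insert hK heE
      have hrank := matroidRank_closure_insert hK heE (fun he => heH (hKH.subset he))
      have hlt := matroidRank_lt_of_ssubset hK hH.1 hKH
      have hmem : M.closure (insert e K) ∈ flatsIco M (M.closure (insert e A)) B := by
        refine ⟨M.isFlat_closure _, M.closure_subset_closure (Set.insert_subset_insert hAK),
          (closure_insert_subset hB hKB.2.2.subset heB).ssubset_of_ne fun heq => ?_⟩
        rw [heq] at hrank
        omega
      exact subset_of_flat_subset hun (hproper hKB) (hproper (hS (heS hmem)))
        ((Set.subset_insert e K).trans hsub) (h _ (heS hmem))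
    · exact subset_of_flat_subset hun (hproper hKB) (hproper hH) hKH.subset h
  · intro h
    by_cases hσ : σ ∈ Z H
    · exact Or.inr hσ
    refine Or.inl fun K hKS => ?_
    have hK := hS hKS
    have hnot : ¬ H ⊆ K := by
      intro hsub
      have hlt₁ := matroidRank_lt_of_ssubset hH.1 hK.1
        (hsub.ssubset_of_ne fun heq => hHS (heq ▸ hKS))
      have hlt₂ := matroidRank_lt_of_ssubset hK.1 hB hK.2.2
      omega
    have hmem : K ∩ H ∈ flatsIco M A H :=
      ⟨isFlat_inter hK.1 hH.1, Set.subset_inter hK.2.1 hH.2.1,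
        Set.inter_subset_right.ssubset_of_ne fun heq => hnot (Set.inter_eq_right.1 heq)⟩
    have hσ' := h _ hmem
    rw [hun K (hproper hK) H (hproper hH)] at hσ'
    exact hσ'.resolve_right hσ

/-- If each `Z K`, for the flats `A ⊆ K ⊂ B`, has vanishing homology in the degree complementary
to its rank, then so does the intersection of these complexes. -/
theorem isExactAt_biInter_flatsIco [LinearOrder W] (F : Type) [Field F]
    (hcx : ∀ K ∈ ProperFlats M, IsComplex (Z K))
    (hun : ∀ K ∈ ProperFlats M, ∀ K' ∈ ProperFlats M, Z (K ∩ K') = Z K ∪ Z K')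
    {A B : Set V} (hA : M.IsFlat A) (hB : M.IsFlat B) (hAB : A ⊂ B) (j : ℕ)
    (hex : ∀ K ∈ flatsIco M A B, ∀ n, n + matroidRank M K + 1 = j + matroidRank M B →
      IsExactAt F (Z K) n) :
    IsExactAt F (⋂ K ∈ flatsIco M A B, Z K) j := by
  induction hd : matroidRank M B - matroidRank M A using Nat.strong_induction_on
    generalizing A B j with
  | _ d ih =>
  have hproper := flatsIco_subset_properFlats (A := A) hB
  have hlt := matroidRank_lt_of_ssubset hA hB hAB
  by_cases hone : matroidRank M B = matroidRank M A + 1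
  · have hsingle : flatsIco M A B = {A} := by
      ext K
      refine ⟨fun hK => ?_, by rintro rfl; exact ⟨hA, subset_rfl, hAB⟩⟩
      by_contra hne
      have hlt₁ := matroidRank_lt_of_ssubset hA hK.1 (hK.2.1.ssubset_of_ne (Ne.symm hne))
      have hlt₂ := matroidRank_lt_of_ssubset hK.1 hB hK.2.2
      omega
    rw [hsingle, Set.biInter_singleton]
    exact hex A ⟨hA, subset_rfl, hAB⟩ j (by omega)
  obtain ⟨e, heB, heA⟩ := Set.exists_of_ssubset hAB
  have heE := hB.subset_ground heB
  have hsubA := subset_closure_insert hA heE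
  have hrankA := matroidRank_closure_insert hA heE heA
  have hupper : flatsIco M (M.closure (insert e A)) B ⊆ flatsIco M A B := fun K hK =>
    ⟨hK.1, (Set.subset_insert e A).trans (hsubA.trans hK.2.1), hK.2.2⟩
  let P : Set (Set V) := {H | H ∈ flatsIco M A B ∧ e ∉ H ∧ matroidRank M H + 1 = matroidRank M B}
  have hstep : ∀ T : Set (Set V), T ⊆ P →
      IsExactAt F (⋂ K ∈ flatsIco M (M.closure (insert e A)) B ∪ T, Z K) j := by
    intro T
    induction T, Set.toFinite T using Set.Finite.induction_on with
    | empty =>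
      intro _
      rw [Set.union_empty]
      refine ih _ ?_ (M.isFlat_closure _) hB
        ((closure_insert_subset hB hAB.subset heB).ssubset_of_ne fun heq => ?_) j
        (fun K hK => hex K (hupper hK)) rfl
      · omega
      · rw [heq] at hrankA
        exact hone hrankA
    | @insert H T hHT _ ihT =>
      intro hT
      obtain ⟨hH, heH, hHB⟩ := hT (Set.mem_insert H T)
      have hTP := (Set.subset_insert H T).trans hT
      have hS : flatsIco M (M.closure (insert e A)) B ∪ T ⊆ flatsIco M A B :=
        Set.union_subset hupper fun K hK => (hTP hK).1
      have hHS : H ∉ flatsIco M (M.closure (insert e A)) B ∪ T := by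
        rintro (h | h)
        · exact heH (h.2.1 (hsubA (Set.mem_insert e A)))
        · exact hHT h
      rw [Set.union_insert, Set.biInter_insert, Set.inter_comm]
      refine IsExactAt.inter F (isComplex_biInter fun K hK => hcx K (hproper (hS hK)))
        (hcx H (hproper hH)) (ihT hTP) (hex H hH j (by omega)) ?_
      rw [biInter_union_corank_one hun hB heB hS Set.subset_union_left hH heH hHS hHB]
      refine ih _ ?_ hA hH.1 (hH.2.1.ssubset_of_ne fun heq => ?_) (j + 1)
        (fun K hK n hn => hex K ⟨hK.1, hK.2.1, hK.2.2.trans hH.2.2⟩ n (by omega)) rfl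
      · omega
      · rw [heq] at hone
        omega
  convert hstep P subset_rfl using 1
  refine subset_antisymm
    (Set.biInter_subset_biInter_left (Set.union_subset hupper fun K hK => hK.1)) ?_
  intro σ hσ
  simp only [Set.mem_iInter] at hσ ⊢
  intro K hK
  obtain ⟨H, hH, hKH, hHB⟩ := exists_corank_one_flat_superset hB hK
  refine subset_of_flat_subset hun (hproper hK) (hproper hH) hKH (hσ H ?_)
  by_cases heH : e ∈ H
  · exact Or.inl ⟨hH.1, closure_insert_subset hH.1 hH.2.1 heH, hH.2.2⟩
  · exact Or.inr ⟨hH, heH, hHB⟩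

end FlatFamilies

/-- **Empty intersections give non-vanishing homology** (Corollary 3.3).
Let `M` be a matroid of rank `m ≥ 1` on the finite ground set `V` and let
`{Z K : K ∈ K(M)}` be complexes (each containing the empty simplex) on a common finite
vertex set `W` with `Z K ∪ Z K' = Z (K ∩ K')` for all proper flats `K, K'`.
If `⋂_{K ∈ K(M)} Z K = {∅}`, then there are `0 ≤ p ≤ m-1` and a proper flat `K` with
`ρ_M(K) = m-p-1` such that `h̃_{p-1}(Z K; F) ≠ 0`. -/
theorem empty_intersection_nonvanishing_homology
    {V : Type} [Fintype V] {W : Type} [Fintype W] [LinearOrder W] (F : Type) [Field F]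
    (M : Matroid V) (hME : M.E = Set.univ)
    (m : ℕ) (hm : matroidRank M Set.univ = m) (hm1 : 1 ≤ m)
    (Z : ProperFlats M → Set (Finset W))
    (hZcx : ∀ K, IsComplex (Z K)) (hZempty : ∀ K, ∅ ∈ Z K)
    (hZunion : ∀ (K K' : ProperFlats M) (h : (K : Set V) ∩ (K' : Set V) ∈ ProperFlats M),
      Z K ∪ Z K' = Z ⟨(K : Set V) ∩ (K' : Set V), h⟩)
    (hZint : ⋂ K : ProperFlats M, Z K = {∅}) :
    ∃ p : ℕ, p ≤ m - 1 ∧ ∃ K : ProperFlats M,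
      matroidRank M (K : Set V) = m - p - 1 ∧ Nontrivial (RH F (Z K) p) := by
  classical
  by_contra hcon
  push Not at hcon
  let Z' : Set V → Set (Finset W) := fun K => if h : K ∈ ProperFlats M then Z ⟨K, h⟩ else ∅
  have hZ' : ∀ K (hK : K ∈ ProperFlats M), Z' K = Z ⟨K, hK⟩ := fun K hK => dif_pos hK
  have hinter : ∀ K ∈ ProperFlats M, ∀ K' ∈ ProperFlats M, K ∩ K' ∈ ProperFlats M :=
    fun K hK K' hK' => ⟨isFlat_inter hK.1 hK'.1, fun heq => hK.2 <|
      subset_antisymm hK.1.subset_ground (heq ▸ Set.inter_subset_left)⟩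
  have hrank : matroidRank M M.E = m := by rw [hME, hm]
  have hlt : M.closure ∅ ⊂ M.E := by
    refine (M.closure_subset_ground ∅).ssubset_of_ne fun heq => ?_
    have h := matroidRank_eq_eRk M M.E
    rw [← heq, M.eRk_closure_eq, M.eRk_empty, heq, hrank] at h
    have : m = 0 := by exact_mod_cast h
    omega
  have hflats : flatsIco M (M.closure ∅) M.E = ProperFlats M := by
    refine subset_antisymm (flatsIco_subset_properFlats M.ground_isFlat) fun K hK => ?_
    refine ⟨hK.1, ?_, hK.1.subset_ground.ssubset_of_ne hK.2⟩
    rw [← hK.1.closure]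
    exact M.closure_subset_closure (Set.empty_subset K)
  have hexact := isExactAt_biInter_flatsIco F (Z := Z')
    (fun K hK => hZ' K hK ▸ hZcx _)
    (fun K hK K' hK' => by
      rw [hZ' K hK, hZ' K' hK', hZ' _ (hinter K hK K' hK')]
      exact (hZunion ⟨K, hK⟩ ⟨K', hK'⟩ _).symm)
    (M.isFlat_closure ∅) M.ground_isFlat hlt 0
    (fun K hK n hn => by
      rw [hflats] at hK
      rw [hZ' K hK]
      exact isExactAt_of_subsingleton_RH F (hZcx _)
        (hcon n (by omega) ⟨K, hK⟩ (by simp only; omega)))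
  have hZ_inter : ⋂ K ∈ ProperFlats M, Z' K = {∅} := by
    rw [Set.biInter_eq_iInter, ← hZint]
    exact Set.iInter_congr fun K => hZ' K K.2
  rw [hflats, hZ_inter] at hexact
  exact not_isExactAt_singleton_empty F hexact
end

section
/- Let X be a simplicial complex on a finite vertex set V with V ∉ X, and let M be a matroid on V (identified with the complex of its independent sets) with M ⊆ X. For each proper flat K of the dual matroid M*, let Z_K = Δ(X^∨ \ X^∨[K]). Then ⋂_{K ∈ K(M*)} Z_K = {∅}; that is, every simplex σ ∈ X^∨ is contained in some proper flat K of M*, hence σ is not a vertex of Z_K. -/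
open Finset

variable {V : Type*}

/-- The order complex `Δ(P)` of a subset `P` of a poset: the complex of finite chains
contained in `P`. -/
def orderComplex {α : Type*} [Preorder α] (P : Set α) : Set (Finset α) :=
  {C | ↑C ⊆ P ∧ IsChain (· ≤ ·) (↑C : Set α)}

/-- For `K ⊆ V`, the complex `Z_K = Δ(X^∨ \ X^∨[K])`: the order complex of the poset
(ordered by inclusion) of simplices of `X^∨` not contained in `K`. -/
def ZComplex {V : Type*} [Fintype V] [DecidableEq V] (X : Set (Finset V)) (K : Set V) :
    Set (Finset (Finset V)) :=
  orderComplex {σ : Finset V | σ ∈ alexDual X ∧ ¬ (↑σ : Set V) ⊆ K}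

/-- The closure in `M✶` of a simplex of the Alexander dual is not the whole ground set:
otherwise the complement of the simplex would be independent in `M`, hence in `X`. -/
theorem closure_dual_ne_ground_of_mem_alexDual {V : Type*} [Fintype V] [DecidableEq V]
    {X : Set (Finset V)} {M : Matroid V} (hME : M.E = Set.univ) (hMX : indepComplex M ⊆ X)
    {σ : Finset V} (hσ : σ ∈ alexDual X) : M✶.closure ↑σ ≠ M✶.E := by
  intro h
  have hE : (σ : Set V) ⊆ M✶.E := by simp [hME]
  have hsp : M✶.Spanning ↑σ := (Matroid.spanning_iff_closure_eq hE).2 h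
  have hind := (Matroid.spanning_iff_compl_coindep hE).1 hsp
  rw [Matroid.Coindep, Matroid.dual_dual, Matroid.dual_ground, hME,
    ← Set.compl_eq_univ_sdiff] at hind
  refine hσ (hMX ?_)
  simpa [indepComplex] using hind

/-- **Step in the proof of the main theorem**: if `V ∉ X` and `M` is a matroid on `V`
with `M ⊆ X`, then every simplex `σ ∈ X^∨` is contained in some proper flat `K` of the
dual matroid `M✶` (hence `σ` is not a vertex of `Z_K`), and consequently
`⋂_{K ∈ K(M✶)} Z_K = {∅}`. -/
theorem ZComplex_inter_eq_empty_simplex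
    {V : Type} [Fintype V] [DecidableEq V]
    (X : Set (Finset V)) (hX : IsComplex X) (hV : (Finset.univ : Finset V) ∉ X)
    (M : Matroid V) (hME : M.E = Set.univ)
    (hMX : indepComplex M ⊆ X) :
    (∀ σ ∈ alexDual X, ∃ K : Set V, (M✶.IsFlat K ∧ K ≠ M✶.E) ∧ (↑σ : Set V) ⊆ K) ∧
      ⋂ K : {K : Set V // M✶.IsFlat K ∧ K ≠ M✶.E}, ZComplex X (K : Set V) = {∅} := by
  have hflat : ∀ σ ∈ alexDual X,
      ∃ K : Set V, (M✶.IsFlat K ∧ K ≠ M✶.E) ∧ (↑σ : Set V) ⊆ K := fun σ hσ =>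
    ⟨M✶.closure ↑σ, ⟨M✶.isFlat_closure _, closure_dual_ne_ground_of_mem_alexDual hME hMX hσ⟩,
      M✶.subset_closure _ (by simp [hME])⟩
  refine ⟨hflat, Set.eq_singleton_iff_unique_mem.2 ⟨?_, fun C hC => ?_⟩⟩
  · simp [ZComplex, orderComplex]
  · rw [Set.mem_iInter] at hC
    refine Finset.eq_empty_of_forall_notMem fun σ hσ => ?_
    obtain ⟨K₀, hK₀, -⟩ := hflat ∅ (by simpa [alexDual] using hV)
    obtain ⟨K, hK, hσK⟩ := hflat σ ((hC ⟨K₀, hK₀⟩).1 hσ).1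
    exact ((hC ⟨K, hK⟩).1 hσ).2 hσK
end

section
/- Let M be a matroid on ground set V with ρ_M(V) = m ≥ 1, let {Y_K : K ∈ K(M)} be simplicial complexes on a common vertex set with Y_K ∩ Y_{K'} = Y_{K ∩ K'} for all proper flats K, K', let Y = ⋃_{K ∈ K(M)} Y_K, and let F_{m−1} = ⋃_{K ∈ K(M)} Y_K × Δ(K(M)_{≥K}) ⊆ Y × Δ(K(M)) (products of geometric realizations). Then the projection φ: F_{m−1} → Y onto the first coordinate has contractible fibers — for y ∈ Y, φ^{−1}(y) = {y} × Δ(K(M)_{≥K_y}) where K_y = ⋂{K ∈ K(M) : y ∈ Y_K} — and φ induces an isomorphism H_*(F_{m−1}; F) ≅ H_*(Y; F). -/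
open Finset

variable {V : Type*}

/-- The geometric realization `|Z|` of a simplicial complex `Z` on the vertex type `W`,
as a subspace of `W → ℝ`: the points supported on a simplex of `Z`, with nonnegative
coordinates summing to `1`. -/
def geomRel {W : Type*} (Z : Set (Finset W)) : Set (W → ℝ) :=
  {f | ∃ σ ∈ Z, (∀ w, 0 ≤ f w) ∧ (∀ w, f w ≠ 0 → w ∈ σ) ∧ ∑ w ∈ σ, f w = 1}

/-- The union `⋃_{K ∈ K(M), ρ_M(K) ≥ r} |Y_K| × |Δ(K(M)_{≥K})|`, a subset of
`|Y| × |Δ(K(M))|`; the filtration piece `F_p` of Proposition 3.1 is obtained for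
`r = m - p - 1` (and `F_{p-1}` for `r = m - p`). -/
def FiltUnion {V W : Type*} (M : Matroid V) (Y : ProperFlats M → Set (Finset W)) (r : ℕ) :
    Set ((W → ℝ) × (↥(ProperFlats M) → ℝ)) :=
  ⋃ K : {K : ↥(ProperFlats M) // r ≤ matroidRank M (K : Set V)},
    geomRel (Y K.1) ×ˢ
      geomRel (orderComplex {J : ↥(ProperFlats M) | (K.1 : Set V) ⊆ (J : Set V)})

/-- The topological simplex associated to `x : SimplexCategory` (formerly in Mathlib). -/
def SimplexCategory.toTopObj (x : SimplexCategory) : Set (Fin (x.len + 1) → NNReal) :=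
  {f | ∑ i, f i = 1}

/-- A morphism in `SimplexCategory` induces a map on the associated topological simplices
(formerly in Mathlib). -/
noncomputable def SimplexCategory.toTopMap {x y : SimplexCategory} (f : x ⟶ y)
    (g : x.toTopObj) : y.toTopObj :=
  ⟨fun i => ∑ j ∈ Finset.univ.filter (fun j => f.toOrderHom j = i), g.1 j, by
    have hg : ∑ j, g.1 j = 1 := g.2
    exact (Finset.sum_fiberwise Finset.univ (fun j => f.toOrderHom j) g.1).trans hg⟩

theorem SimplexCategory.continuous_toTopMap {x y : SimplexCategory} (f : x ⟶ y) :
    Continuous (SimplexCategory.toTopMap f) :=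
  Continuous.subtype_mk (continuous_pi fun _ => continuous_finset_sum _
    (fun j _ => (continuous_apply j).comp continuous_subtype_val)) _

section SingularHomology

variable (F : Type) [Field F]

/-- The topological standard `n`-simplex. -/
abbrev TSimp (n : ℕ) : Type :=
  (SimplexCategory.toTopObj (SimplexCategory.mk n) : Type)

/-- Singular `n`-chains of a topological space `X` with coefficients in `F`:
formal `F`-linear combinations of continuous maps `Δ^n → X`. -/
def SingChain (X : Type) [TopologicalSpace X] (n : ℕ) : Type :=
  C(TSimp n, X) →₀ F

noncomputable instance (X : Type) [TopologicalSpace X] (n : ℕ) :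
    AddCommGroup (SingChain F X n) :=
  inferInstanceAs (AddCommGroup (C(TSimp n, X) →₀ F))

noncomputable instance (X : Type) [TopologicalSpace X] (n : ℕ) :
    Module F (SingChain F X n) :=
  inferInstanceAs (Module F (C(TSimp n, X) →₀ F))

/-- The `i`-th face inclusion `Δ^n → Δ^{n+1}` as a continuous map. -/
noncomputable def faceMap (n : ℕ) (i : Fin (n + 2)) : C(TSimp n, TSimp (n + 1)) :=
  ⟨SimplexCategory.toTopMap (SimplexCategory.δ i),
    SimplexCategory.continuous_toTopMap _⟩

/-- The boundary of a singular `(n+1)`-simplex: the alternating sum of its faces. -/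
noncomputable def singBdryElem (X : Type) [TopologicalSpace X] (n : ℕ)
    (σ : C(TSimp (n + 1), X)) : SingChain F X n :=
  ∑ i : Fin (n + 2),
    ((-1 : F) ^ (i : ℕ)) • (Finsupp.single (σ.comp (faceMap n i)) 1 : SingChain F X n)

/-- The singular boundary map. -/
noncomputable def singBdry (X : Type) [TopologicalSpace X] (n : ℕ) :
    SingChain F X (n + 1) →ₗ[F] SingChain F X n :=
  Finsupp.lsum F fun σ => LinearMap.toSpanSingleton F (SingChain F X n)
    (singBdryElem F X n σ)

/-- Singular cycles. -/
noncomputable def singCyc (X : Type) [TopologicalSpace X] :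
    (n : ℕ) → Submodule F (SingChain F X n)
  | 0 => ⊤
  | (n + 1) => LinearMap.ker (singBdry F X n)

/-- Singular homology `H_n(X; F)`. -/
abbrev SingH (X : Type) [TopologicalSpace X] (n : ℕ) : Type :=
  singCyc F X n ⧸ Submodule.comap (singCyc F X n).subtype
    (LinearMap.range (singBdry F X n))

/-- The pushforward of singular chains along a continuous map. -/
noncomputable def pushf {X Y : Type} [TopologicalSpace X] [TopologicalSpace Y]
    (f : C(X, Y)) (n : ℕ) : SingChain F X n →ₗ[F] SingChain F Y n :=
  Finsupp.lsum F fun σ => LinearMap.toSpanSingleton F (SingChain F Y n)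
    (Finsupp.single (f.comp σ) 1)

/-- The augmented singular chain complex: `ASing F X 0 = F` (the degree `-1` part), and
`ASing F X (n+1)` is the group of singular `n`-chains. -/
def ASing (X : Type) [TopologicalSpace X] : ℕ → Type
  | 0 => F
  | (n + 1) => SingChain F X n

noncomputable instance (X : Type) [TopologicalSpace X] :
    ∀ n, AddCommGroup (ASing F X n)
  | 0 => inferInstanceAs (AddCommGroup F)
  | (n + 1) => inferInstanceAs (AddCommGroup (SingChain F X n))

noncomputable instance (X : Type) [TopologicalSpace X] :
    ∀ n, Module F (ASing F X n)
  | 0 => inferInstanceAs (Module F F)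
  | (n + 1) => inferInstanceAs (Module F (SingChain F X n))

/-- The boundary map of the augmented singular chain complex; in lowest degree it is the
augmentation `C_0(X) → F`. -/
noncomputable def augBdry (X : Type) [TopologicalSpace X] :
    (n : ℕ) → (ASing F X (n + 1) →ₗ[F] ASing F X n)
  | 0 => (Finsupp.lsum F fun _ => LinearMap.id : (C(TSimp 0, X) →₀ F) →ₗ[F] F)
  | (n + 1) => singBdry F X n

/-- Cycles of the augmented singular chain complex. -/
noncomputable def augCyc (X : Type) [TopologicalSpace X] :
    (n : ℕ) → Submodule F (ASing F X n)
  | 0 => ⊤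
  | (n + 1) => LinearMap.ker (augBdry F X n)

/-- `RedSingH F X n` is the reduced singular homology `h̃_{n-1}(X; F)` (note the degree
shift coming from the augmentation). -/
abbrev RedSingH (X : Type) [TopologicalSpace X] (n : ℕ) : Type :=
  augCyc F X n ⧸ Submodule.comap (augCyc F X n).subtype
    (LinearMap.range (augBdry F X n))

/-- Relative singular cycles for a pair `(X, A)` with `A ⊆ X`: chains in `X` whose
boundary is a chain in `A`. -/
noncomputable def relCyc (X : Type) [TopologicalSpace X] (A : Set X) :
    (n : ℕ) → Submodule F (SingChain F X n)
  | 0 => ⊤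
  | (n + 1) => Submodule.comap (singBdry F X n)
      (LinearMap.range (pushf F (⟨Subtype.val, continuous_subtype_val⟩ : C(A, X)) n))

/-- Relative singular homology `H_n(X, A; F)`: relative cycles modulo the submodule
generated by boundaries and chains in `A`. -/
abbrev RelSingH (X : Type) [TopologicalSpace X] (A : Set X) (n : ℕ) : Type :=
  relCyc F X A n ⧸ Submodule.comap (relCyc F X A n).subtype
    (LinearMap.range (singBdry F X n) ⊔
      LinearMap.range (pushf F (⟨Subtype.val, continuous_subtype_val⟩ : C(A, X)) n))

end SingularHomology

section PrismOperator

variable (F : Type) [Field F] {A B : Type*}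

/-- The alternating face map on formal linear combinations of tuples of vertices. -/
noncomputable def tupleBdry (E : Type*) (k : ℕ) :
    ((Fin (k + 1) → E) →₀ F) →ₗ[F] ((Fin k → E) →₀ F) :=
  Finsupp.linearCombination F fun e =>
    ∑ i : Fin (k + 1), ((-1 : F) ^ (i : ℕ)) • Finsupp.single (e ∘ i.succAbove) 1

/-- The cone operator on formal linear combinations of tuples: prepend the vertex `a`. -/
noncomputable def tupleCone {E : Type*} (a : E) (k : ℕ) :
    ((Fin k → E) →₀ F) →ₗ[F] ((Fin (k + 1) → E) →₀ F) :=
  Finsupp.lmapDomain F F fun e => (Fin.cons a e : Fin (k + 1) → E)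

/-- The map on formal linear combinations of tuples induced by a map of vertices. -/
noncomputable def tupleMap (f : A → B) (k : ℕ) :
    ((Fin k → A) →₀ F) →ₗ[F] ((Fin k → B) →₀ F) :=
  Finsupp.lmapDomain F F fun e => f ∘ e

variable {F}

@[simp]
theorem tupleBdry_single {E : Type*} (k : ℕ) (e : Fin (k + 1) → E) :
    tupleBdry F E k (Finsupp.single e 1) =
      ∑ i : Fin (k + 1), ((-1 : F) ^ (i : ℕ)) • Finsupp.single (e ∘ i.succAbove) 1 := by
  simp [tupleBdry]

@[simp]
theorem tupleCone_single {E : Type*} (a : E) (k : ℕ) (e : Fin k → E) (r : F) :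
    tupleCone F a k (Finsupp.single e r) = Finsupp.single (Fin.cons a e) r := by
  simp [tupleCone]

@[simp]
theorem tupleMap_single (f : A → B) (k : ℕ) (e : Fin k → A) (r : F) :
    tupleMap F f k (Finsupp.single e r) = Finsupp.single (f ∘ e) r := by
  simp [tupleMap]

theorem tupleBdry_cone {E : Type*} (a : E) (k : ℕ) (x : (Fin (k + 1) → E) →₀ F) :
    tupleBdry F E (k + 1) (tupleCone F a (k + 1) x) = x - tupleCone F a k (tupleBdry F E k x) := by
  induction x using Finsupp.induction_linear with
  | zero => simp
  | add x y hx hy => simp only [map_add, hx, hy]; abel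
  | single e r =>
    rw [← mul_one r, ← smul_eq_mul, ← Finsupp.smul_single]
    simp only [map_smul, ← smul_sub]
    congr 1
    rw [tupleCone_single, tupleBdry_single, Fin.sum_univ_succ, tupleBdry_single, map_sum,
      sub_eq_add_neg, ← Finset.sum_neg_distrib]
    congr 1
    · simp [Function.comp_def]
    · refine Finset.sum_congr rfl fun i _ => ?_
      have : (Fin.cons a e : Fin (k + 2) → E) ∘ i.succ.succAbove =
          Fin.cons a (e ∘ i.succAbove) := by
        funext j
        refine Fin.cases ?_ (fun j => ?_) j <;> simp
      rw [this, map_smul, tupleCone_single, Fin.val_succ, pow_succ]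
      simp

theorem tupleBdry_map (f : A → B) (k : ℕ) (x : (Fin (k + 1) → A) →₀ F) :
    tupleBdry F B k (tupleMap F f (k + 1) x) = tupleMap F f k (tupleBdry F A k x) := by
  induction x using Finsupp.induction_linear with
  | zero => simp
  | add x y hx hy => simp only [map_add, hx, hy]
  | single e r =>
    rw [← mul_one r, ← smul_eq_mul, ← Finsupp.smul_single]
    simp only [map_smul]
    simp [Function.comp_assoc]

theorem tupleMap_cone (f : A → B) (a : A) (k : ℕ) (x : (Fin k → A) →₀ F) :
    tupleMap F f (k + 1) (tupleCone F a k x) = tupleCone F (f a) k (tupleMap F f k x) := by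
  induction x using Finsupp.induction_linear with
  | zero => simp
  | add x y hx hy => simp only [map_add, hx, hy]
  | single e r => simp [Fin.comp_cons]

variable (F)

/-- The prism operator: it decomposes the prism over a simplex with ordered vertices
`e 0, …, e (k - 1)` into simplices with vertices in `A × Bool`. -/
noncomputable def tuplePrism (A : Type*) :
    (k : ℕ) → ((Fin k → A) →₀ F) →ₗ[F] ((Fin (k + 1) → A × Bool) →₀ F)
  | 0 => 0
  | (k + 1) => Finsupp.linearCombination F fun e =>
      tupleCone F (e 0, false) (k + 1)
        (tupleMap F (fun a => (a, true)) (k + 1) (Finsupp.single e 1) -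
          tuplePrism A k (Finsupp.single (Fin.tail e) 1))

variable {F}

theorem tuplePrism_single (k : ℕ) (e : Fin (k + 1) → A) :
    tuplePrism F A (k + 1) (Finsupp.single e 1) =
      tupleCone F (e 0, false) (k + 1)
        (tupleMap F (fun a => (a, true)) (k + 1) (Finsupp.single e 1) -
          tuplePrism F A k (Finsupp.single (Fin.tail e) 1)) := by
  simp [tuplePrism]

theorem tuplePrism_cone (a : A) (k : ℕ) (x : (Fin k → A) →₀ F) :
    tuplePrism F A (k + 1) (tupleCone F a k x) =
      tupleCone F (a, false) (k + 1)
        (tupleMap F (fun a => (a, true)) (k + 1) (tupleCone F a k x) - tuplePrism F A k x) := by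
  induction x using Finsupp.induction_linear with
  | zero => simp
  | add x y hx hy => simp only [map_add, hx, hy, map_sub]; abel
  | single e r =>
    rw [← mul_one r, ← smul_eq_mul, ← Finsupp.smul_single]
    simp only [map_smul, ← smul_sub]
    congr 1
    rw [tupleCone_single, tuplePrism_single]
    simp

theorem tuplePrism_map (f : A → B) (k : ℕ) (e : Fin k → A) :
    tuplePrism F B k (Finsupp.single (f ∘ e) 1) =
      tupleMap F (Prod.map f id) (k + 1) (tuplePrism F A k (Finsupp.single e 1)) := by
  induction k with
  | zero => simp [tuplePrism]
  | succ k ih =>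
    have h := ih (Fin.tail e)
    rw [show f ∘ Fin.tail e = Fin.tail (f ∘ e) from rfl] at h
    rw [tuplePrism_single, tuplePrism_single, tupleMap_cone, map_sub, h]
    simp [Function.comp_def]

theorem single_eq_tupleCone_tail {E : Type*} (k : ℕ) (e : Fin (k + 1) → E) :
    (Finsupp.single e 1 : (Fin (k + 1) → E) →₀ F) =
      tupleCone F (e 0) k (Finsupp.single (Fin.tail e) 1) := by
  rw [tupleCone_single, Fin.cons_self_tail]

theorem tupleBdry_prism (k : ℕ) (e : Fin (k + 1) → A) :
    tupleBdry F (A × Bool) (k + 1) (tuplePrism F A (k + 1) (Finsupp.single e 1)) +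
        tuplePrism F A k (tupleBdry F A k (Finsupp.single e 1)) =
      Finsupp.single (fun i => (e i, true)) 1 - Finsupp.single (fun i => (e i, false)) 1 := by
  induction k with
  | zero =>
    rw [tuplePrism_single, tupleBdry_cone]
    simp [tuplePrism, Function.comp_def]
    congr 1
    funext i
    obtain rfl : i = 0 := Fin.fin_one_eq_zero i
    rfl
  | succ k ih =>
    have hlin : ∀ x : (Fin (k + 1) → A) →₀ F,
        tupleBdry F (A × Bool) (k + 1) (tuplePrism F A (k + 1) x) =
          tupleMap F (fun a => (a, true)) (k + 1) x - tupleMap F (fun a => (a, false)) (k + 1) x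
            - tuplePrism F A k (tupleBdry F A k x) := by
      intro x
      induction x using Finsupp.induction_linear with
      | zero => simp
      | add x y hx hy => simp only [map_add, hx, hy]; abel
      | single e r =>
        rw [← mul_one r, ← smul_eq_mul, ← Finsupp.smul_single]
        simp only [map_smul, ← smul_sub]
        congr 1
        rw [eq_sub_iff_add_eq, ih]
        simp [Function.comp_def]
    have ht : (Finsupp.single (fun i => (e i, true)) 1 : (Fin (k + 2) → A × Bool) →₀ F) =
        tupleMap F (fun a => (a, true)) (k + 2) (Finsupp.single e 1) := by
      simp [Function.comp_def]
    have hf : (Finsupp.single (fun i => (e i, false)) 1 : (Fin (k + 2) → A × Bool) →₀ F) =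
        tupleMap F (fun a => (a, false)) (k + 2) (Finsupp.single e 1) := by
      simp [Function.comp_def]
    rw [ht, hf, single_eq_tupleCone_tail (F := F) _ e]
    set x : (Fin (k + 1) → A) →₀ F := Finsupp.single (Fin.tail e) 1
    rw [tuplePrism_cone, tupleBdry_cone, tupleBdry_cone, map_sub, tupleBdry_map, tupleBdry_cone,
      hlin x, map_sub (tuplePrism F A (k + 1)), tuplePrism_cone,
      tupleMap_cone (fun a => (a, false))]
    simp only [map_sub]
    abel

end PrismOperator

section HomotopyInvariance

variable (F : Type) [Field F] {X Y Z : Type} [TopologicalSpace X] [TopologicalSpace Y]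
  [TopologicalSpace Z]

/-- The map of standard simplices induced by an arbitrary map of vertices. -/
noncomputable def vertexMap {k n : ℕ} (v : Fin (k + 1) → Fin (n + 1)) : C(TSimp k, TSimp n) where
  toFun g := ⟨fun i => ∑ j with v j = i, g.1 j,
    (Finset.sum_fiberwise Finset.univ v g.1).trans g.2⟩
  continuous_toFun := Continuous.subtype_mk (continuous_pi fun _ => continuous_finsetSum _
    fun j _ => (continuous_apply j).comp continuous_subtype_val) _

/-- The affine function on the standard simplex taking the value `1` at the vertices where `b`
is true and `0` at the others. -/
noncomputable def vertexTime {k : ℕ} (b : Fin (k + 1) → Bool) : C(TSimp k, unitInterval) where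
  toFun g := ⟨((∑ j with b j = true, g.1 j : NNReal) : ℝ), NNReal.coe_nonneg _, by
    have hg : ∑ j, g.1 j = 1 := g.2
    have : ∑ j with b j = true, g.1 j ≤ 1 :=
      hg ▸ Finset.sum_le_sum_of_subset (Finset.filter_subset _ _)
    exact_mod_cast this⟩
  continuous_toFun := Continuous.subtype_mk (NNReal.continuous_coe.comp
    (continuous_finsetSum _ fun j _ => (continuous_apply j).comp continuous_subtype_val)) _

theorem faceMap_eq_vertexMap (n : ℕ) (i : Fin (n + 2)) : faceMap n i = vertexMap i.succAbove :=
  rfl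

theorem sum_filter_vertexMap {k n : ℕ} (v : Fin (k + 1) → Fin (n + 1)) (g : TSimp k)
    (p : Fin (n + 1) → Prop) [DecidablePred p] :
    ∑ i with p i, (vertexMap v g).1 i = ∑ j with p (v j), g.1 j := by
  simp only [vertexMap, ContinuousMap.coe_mk, Finset.sum_filter]
  rw [← Finset.sum_fiberwise Finset.univ v (fun j => if p (v j) then g.1 j else 0)]
  refine Finset.sum_congr rfl fun i _ => ?_
  rw [Finset.sum_filter]
  split_ifs with h
  · refine Finset.sum_congr rfl fun j _ => ?_
    split_ifs <;> simp_all
  · refine (Finset.sum_eq_zero fun j _ => ?_).symm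
    split_ifs <;> simp_all

theorem vertexMap_comp {k n l : ℕ} (u : Fin (n + 1) → Fin (l + 1)) (v : Fin (k + 1) → Fin (n + 1)) :
    (vertexMap u).comp (vertexMap v) = vertexMap (u ∘ v) := by
  ext g i
  exact congrArg _ (sum_filter_vertexMap v g fun j => u j = i)

theorem vertexTime_comp {k n : ℕ} (b : Fin (n + 1) → Bool) (v : Fin (k + 1) → Fin (n + 1)) :
    (vertexTime b).comp (vertexMap v) = vertexTime (b ∘ v) := by
  ext g
  exact congrArg NNReal.toReal (sum_filter_vertexMap v g fun j => b j = true)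

theorem vertexMap_id (n : ℕ) : vertexMap (id : Fin (n + 1) → Fin (n + 1)) = ContinuousMap.id _ := by
  ext g i
  simp [vertexMap, Finset.filter_eq']

theorem vertexTime_true {k : ℕ} (g : TSimp k) : vertexTime (fun _ => true) g = 1 := by
  have hg : ∑ j, g.1 j = 1 := g.2
  ext
  simpa [vertexTime] using congrArg NNReal.toReal hg

theorem vertexTime_false {k : ℕ} (g : TSimp k) : vertexTime (fun _ => false) g = 0 := by
  ext
  simp [vertexTime]

variable {F} in
theorem lsum_toSpanSingleton_single_one {S N : Type*} [AddCommGroup N] [Module F N] (φ : S → N)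
    (s : S) : Finsupp.lsum F (fun s => LinearMap.toSpanSingleton F N (φ s)) (Finsupp.single s 1) =
      φ s := by
  simp

/-- A singular simplex, as a singular chain. -/
noncomputable def singSimplex {n : ℕ} (σ : C(TSimp n, X)) : SingChain F X n :=
  (Finsupp.single σ 1 : C(TSimp n, X) →₀ F)

theorem singBdry_singSimplex (n : ℕ) (σ : C(TSimp (n + 1), X)) :
    singBdry F X n (singSimplex F σ) =
      ∑ i : Fin (n + 2), ((-1 : F) ^ (i : ℕ)) • singSimplex F (σ.comp (faceMap n i)) :=
  lsum_toSpanSingleton_single_one _ σ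

theorem pushf_singSimplex (f : C(X, Y)) (n : ℕ) (σ : C(TSimp n, X)) :
    pushf F f n (singSimplex F σ) = singSimplex F (f.comp σ) :=
  lsum_toSpanSingleton_single_one _ σ

variable {F} in
/-- Two linear maps out of the singular chains agree if they agree on singular simplices. -/
theorem singChain_hom_ext {N : Type*} [AddCommGroup N] [Module F N] {n : ℕ}
    {f g : SingChain F X n →ₗ[F] N}
    (h : ∀ σ : C(TSimp n, X), f (singSimplex F σ) = g (singSimplex F σ)) : f = g :=
  Finsupp.lhom_ext' fun σ => LinearMap.ext_ring (h σ)

theorem pushf_id (n : ℕ) : pushf F (ContinuousMap.id X) n = LinearMap.id :=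
  singChain_hom_ext fun σ => pushf_singSimplex F _ _ σ

theorem pushf_comp (g : C(Y, Z)) (f : C(X, Y)) (n : ℕ) :
    pushf F (g.comp f) n = pushf F g n ∘ₗ pushf F f n :=
  singChain_hom_ext fun σ => by
    rw [LinearMap.comp_apply, pushf_singSimplex, pushf_singSimplex, pushf_singSimplex,
      ContinuousMap.comp_assoc]

theorem singBdry_pushf (f : C(X, Y)) (n : ℕ) :
    singBdry F Y n ∘ₗ pushf F f (n + 1) = pushf F f n ∘ₗ singBdry F X n :=
  singChain_hom_ext fun σ => by
    rw [LinearMap.comp_apply, LinearMap.comp_apply, pushf_singSimplex, singBdry_singSimplex,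
      singBdry_singSimplex, map_sum]
    refine Finset.sum_congr rfl fun i _ => ?_
    rw [map_smul, pushf_singSimplex,
      ContinuousMap.comp_assoc]

theorem pushf_mem_singCyc (f : C(X, Y)) (n : ℕ) {c : SingChain F X n} (hc : c ∈ singCyc F X n) :
    pushf F f n c ∈ singCyc F Y n := by
  cases n with
  | zero => exact Submodule.mem_top
  | succ n =>
    have h := LinearMap.congr_fun (singBdry_pushf F f n) c
    have hc' : singBdry F X n c = 0 := hc
    simp only [LinearMap.comp_apply, hc', map_zero] at h
    exact h

theorem pushf_mem_range_singBdry (f : C(X, Y)) (n : ℕ) {c : SingChain F X n}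
    (hc : c ∈ LinearMap.range (singBdry F X n)) :
    pushf F f n c ∈ LinearMap.range (singBdry F Y n) := by
  obtain ⟨d, rfl⟩ := hc
  exact ⟨pushf F f (n + 1) d, LinearMap.congr_fun (singBdry_pushf F f n) d⟩

/-- The singular simplex of `Y` traced out, under a map `H : X × [0,1] → Y`, by the affine simplex
of `Δ^n × [0,1]` with vertices `e`, where `σ : Δ^n → X`. -/
noncomputable def prismSimplex (H : C(X × unitInterval, Y)) {n : ℕ} (σ : C(TSimp n, X)) {k : ℕ}
    (e : Fin (k + 1) → Fin (n + 1) × Bool) : C(TSimp k, Y) :=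
  H.comp ((σ.comp (vertexMap (Prod.fst ∘ e))).prodMk (vertexTime (Prod.snd ∘ e)))

theorem prismSimplex_comp_vertexMap (H : C(X × unitInterval, Y)) {n : ℕ} (σ : C(TSimp n, X))
    {k l : ℕ} (e : Fin (k + 1) → Fin (n + 1) × Bool) (v : Fin (l + 1) → Fin (k + 1)) :
    (prismSimplex H σ e).comp (vertexMap v) = prismSimplex H σ (e ∘ v) := by
  rw [prismSimplex, prismSimplex, ← Function.comp_assoc, ← Function.comp_assoc, ← vertexMap_comp,
    ← vertexTime_comp]
  rfl

theorem prismSimplex_comp_face (H : C(X × unitInterval, Y)) {n m : ℕ} (σ : C(TSimp n, X))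
    {k : ℕ} (u : Fin (m + 1) → Fin (n + 1)) (e : Fin (k + 1) → Fin (m + 1) × Bool) :
    prismSimplex H (σ.comp (vertexMap u)) e = prismSimplex H σ (Prod.map u id ∘ e) := by
  rw [prismSimplex, prismSimplex, ContinuousMap.comp_assoc, vertexMap_comp]
  rfl

/-- The linear extension of `prismSimplex`. -/
noncomputable def prismRealize (H : C(X × unitInterval, Y)) {n : ℕ} (σ : C(TSimp n, X)) (k : ℕ) :
    ((Fin (k + 1) → Fin (n + 1) × Bool) →₀ F) →ₗ[F] SingChain F Y k :=
  Finsupp.lmapDomain F F (prismSimplex H σ)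

variable {F} in
theorem prismRealize_single (H : C(X × unitInterval, Y)) {n : ℕ} (σ : C(TSimp n, X)) (k : ℕ)
    (e : Fin (k + 1) → Fin (n + 1) × Bool) :
    prismRealize F H σ k (Finsupp.single e 1) = singSimplex F (prismSimplex H σ e) :=
  Finsupp.mapDomain_single

theorem singBdry_prismRealize (H : C(X × unitInterval, Y)) {n : ℕ} (σ : C(TSimp n, X)) (k : ℕ) :
    singBdry F Y k ∘ₗ prismRealize F H σ (k + 1) =
      prismRealize F H σ k ∘ₗ tupleBdry F _ (k + 1) :=
  Finsupp.lhom_ext' fun e => LinearMap.ext_ring <| by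
    simp only [LinearMap.comp_apply, Finsupp.lsingle_apply]
    rw [prismRealize_single, singBdry_singSimplex, tupleBdry_single, map_sum]
    refine Finset.sum_congr rfl fun i _ => ?_
    rw [map_smul, prismRealize_single, faceMap_eq_vertexMap, prismSimplex_comp_vertexMap]

theorem prismRealize_comp_tupleMap (H : C(X × unitInterval, Y)) {n m : ℕ} (σ : C(TSimp n, X))
    (u : Fin (m + 1) → Fin (n + 1)) (k : ℕ) :
    prismRealize F H σ k ∘ₗ tupleMap F (Prod.map u id) (k + 1) =
      prismRealize F H (σ.comp (vertexMap u)) k :=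
  Finsupp.lhom_ext' fun e => LinearMap.ext_ring <| by
    simp only [LinearMap.comp_apply, Finsupp.lsingle_apply]
    rw [tupleMap_single, prismRealize_single, prismRealize_single, prismSimplex_comp_face]

/-- The chain homotopy induced by a homotopy `H : X × [0,1] → Y`. -/
noncomputable def singPrism (H : C(X × unitInterval, Y)) (n : ℕ) :
    SingChain F X n →ₗ[F] SingChain F Y (n + 1) :=
  Finsupp.lsum F fun σ => LinearMap.toSpanSingleton F (SingChain F Y (n + 1))
    (prismRealize F H σ (n + 1) (tuplePrism F _ (n + 1) (Finsupp.single id 1)))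

variable {F} in
theorem singPrism_singSimplex (H : C(X × unitInterval, Y)) (n : ℕ) (σ : C(TSimp n, X)) :
    singPrism F H n (singSimplex F σ) =
      prismRealize F H σ (n + 1) (tuplePrism F _ (n + 1) (Finsupp.single id 1)) :=
  lsum_toSpanSingleton_single_one _ σ

variable {f g : C(X, Y)}

variable {F} in
theorem prismRealize_ends (H : f.Homotopy g) (n : ℕ) (σ : C(TSimp n, X)) :
    prismRealize F (H.toContinuousMap.comp ⟨Prod.swap, continuous_swap⟩) σ n
        (Finsupp.single (fun i => (i, true)) 1 - Finsupp.single (fun i => (i, false)) 1) =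
      pushf F g n (singSimplex F σ) - pushf F f n (singSimplex F σ) := by
  rw [map_sub, prismRealize_single, prismRealize_single, pushf_singSimplex, pushf_singSimplex]
  have h (b : Bool) : prismSimplex (H.toContinuousMap.comp ⟨Prod.swap, continuous_swap⟩) σ
      (fun i => (i, b)) = H.toContinuousMap.comp ((vertexTime fun _ => b).prodMk σ) := by
    rw [prismSimplex, show Prod.fst ∘ (fun i : Fin (n + 1) => (i, b)) = id from rfl, vertexMap_id]
    rfl
  rw [h, h]
  congr 2
  · ext x
    simp [vertexTime_true]
  · ext x
    simp [vertexTime_false]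

theorem singBdry_singPrism_zero (H : f.Homotopy g) :
    singBdry F Y 0 ∘ₗ singPrism F (H.toContinuousMap.comp ⟨Prod.swap, continuous_swap⟩) 0 =
      pushf F g 0 - pushf F f 0 :=
  singChain_hom_ext fun σ => by
    rw [LinearMap.comp_apply, singPrism_singSimplex, LinearMap.sub_apply, ← prismRealize_ends H,
      ← LinearMap.comp_apply, singBdry_prismRealize, LinearMap.comp_apply]
    have h := tupleBdry_prism (F := F) 0 (id : Fin 1 → Fin 1)
    simp only [tuplePrism, LinearMap.zero_apply, add_zero] at h
    exact congrArg _ h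

theorem singBdry_singPrism_succ (H : f.Homotopy g) (n : ℕ) :
    singBdry F Y (n + 1) ∘ₗ
        singPrism F (H.toContinuousMap.comp ⟨Prod.swap, continuous_swap⟩) (n + 1) +
      singPrism F (H.toContinuousMap.comp ⟨Prod.swap, continuous_swap⟩) n ∘ₗ singBdry F X n =
      pushf F g (n + 1) - pushf F f (n + 1) :=
  singChain_hom_ext fun σ => by
    rw [LinearMap.add_apply, LinearMap.comp_apply, LinearMap.comp_apply, singPrism_singSimplex,
      LinearMap.sub_apply, ← prismRealize_ends H,
      ← LinearMap.comp_apply, singBdry_prismRealize, LinearMap.comp_apply]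
    refine Eq.trans ?_ (congrArg _ (tupleBdry_prism (F := F) (n + 1) id))
    rw [map_add, singBdry_singSimplex, tupleBdry_single]
    simp only [map_sum, map_smul]
    congr 1
    refine Finset.sum_congr rfl fun i _ => ?_
    rw [singPrism_singSimplex, faceMap_eq_vertexMap, ← prismRealize_comp_tupleMap,
      LinearMap.comp_apply, ← tuplePrism_map]
    rfl

/-- Homotopic maps send a cycle to homologous cycles. -/
theorem pushf_sub_pushf_mem_range (h : f.Homotopic g) (n : ℕ) {c : SingChain F X n}
    (hc : c ∈ singCyc F X n) :
    pushf F g n c - pushf F f n c ∈ LinearMap.range (singBdry F Y n) := by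
  obtain ⟨H⟩ := h
  cases n with
  | zero => exact ⟨_, LinearMap.congr_fun (singBdry_singPrism_zero F H) c⟩
  | succ n =>
    have hc' : singBdry F X n c = 0 := hc
    have h := LinearMap.congr_fun (singBdry_singPrism_succ F H n) c
    rw [LinearMap.add_apply, LinearMap.comp_apply, LinearMap.comp_apply, hc', map_zero,
      add_zero] at h
    exact ⟨_, h⟩

/-- A homotopy equivalence induces isomorphisms on singular homology. -/
theorem ContinuousMap.HomotopyEquiv.exists_singH_equiv (E : ContinuousMap.HomotopyEquiv X Y)
    (n : ℕ) :
    ∃ e : SingH F X n ≃ₗ[F] SingH F Y n,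
      ∀ (c : SingChain F X n) (hc : c ∈ singCyc F X n),
        ∃ hc' : pushf F E.toFun n c ∈ singCyc F Y n,
          e (Submodule.Quotient.mk ⟨c, hc⟩) = Submodule.Quotient.mk ⟨pushf F E.toFun n c, hc'⟩ := by
  let p : singCyc F X n →ₗ[F] singCyc F Y n :=
    (pushf F E.toFun n).restrict fun _ hc => pushf_mem_singCyc F E.toFun n hc
  let q : SingH F X n →ₗ[F] SingH F Y n := Submodule.mapQ _ _ p fun c hc =>
    pushf_mem_range_singBdry F E.toFun n hc
  have hq : Function.Bijective q := by
    constructor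
    · rw [injective_iff_map_eq_zero]
      intro x hx
      obtain ⟨⟨c, hc⟩, rfl⟩ := Submodule.Quotient.mk_surjective _ x
      have hb : pushf F E.toFun n c ∈ LinearMap.range (singBdry F Y n) :=
        (Submodule.Quotient.mk_eq_zero (Submodule.comap (singCyc F Y n).subtype
          (LinearMap.range (singBdry F Y n))) (x := p ⟨c, hc⟩)).1 hx
      refine (Submodule.Quotient.mk_eq_zero _).2 ?_
      have h₁ := pushf_mem_range_singBdry F E.invFun n hb
      have h₂ := pushf_sub_pushf_mem_range F E.left_inv n hc
      rw [pushf_id, pushf_comp] at h₂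
      have h₃ := Submodule.add_mem _ h₂ h₁
      rw [LinearMap.comp_apply, sub_add_cancel] at h₃
      exact h₃
    · intro y
      obtain ⟨⟨d, hd⟩, rfl⟩ := Submodule.Quotient.mk_surjective _ y
      refine ⟨Submodule.Quotient.mk ⟨pushf F E.invFun n d, pushf_mem_singCyc F E.invFun n hd⟩, ?_⟩
      refine (Submodule.Quotient.eq _).2 ?_
      have h₂ := pushf_sub_pushf_mem_range F E.right_inv.symm n hd
      rw [pushf_id, pushf_comp] at h₂
      exact h₂
  exact ⟨LinearEquiv.ofBijective q hq, fun c hc => ⟨pushf_mem_singCyc F E.toFun n hc, rfl⟩⟩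

end HomotopyInvariance

section GeometricRealization

theorem homotopic_of_segment_subset {X E : Type*} [TopologicalSpace X] [AddCommGroup E] [Module ℝ E]
    [TopologicalSpace E] [ContinuousAdd E] [ContinuousSMul ℝ E] {S : Set E} (f g : C(X, S))
    (h : ∀ x, segment ℝ (f x : E) (g x) ⊆ S) : f.Homotopic g :=
  ⟨{ toFun := fun p => ⟨(1 - (p.1 : ℝ)) • (f p.2 : E) + (p.1 : ℝ) • (g p.2 : E),
        h p.2 ⟨1 - p.1, p.1, sub_nonneg.2 p.1.2.2, p.1.2.1, sub_add_cancel _ _, rfl⟩⟩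
     continuous_toFun := by fun_prop
     map_zero_left := fun x => by simp
     map_one_left := fun x => by simp }⟩

variable {U : Type*}

theorem mem_geomRel_iff {Z : Set (Finset U)} {f : U → ℝ} :
    f ∈ geomRel Z ↔ ∃ σ ∈ Z, f ∈ geomRel {σ} := by
  simp [geomRel]

theorem nonneg_of_mem_geomRel {Z : Set (Finset U)} {f : U → ℝ} (hf : f ∈ geomRel Z) (w : U) :
    0 ≤ f w := by
  obtain ⟨σ, -, h0, -⟩ := hf
  exact h0 w

theorem geomRel_mono {Z Z' : Set (Finset U)} (h : Z ⊆ Z') : geomRel Z ⊆ geomRel Z' :=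
  fun _ ⟨σ, hσ, hf⟩ => ⟨σ, h hσ, hf⟩

theorem geomRel_singleton_mono {σ τ : Finset U} (h : σ ⊆ τ) : geomRel {σ} ⊆ geomRel {τ} := by
  rintro f ⟨_, rfl, h0, hs, h1⟩
  refine ⟨τ, rfl, h0, fun w hw => h (hs w hw), ?_⟩
  rw [← h1]
  refine (Finset.sum_subset h fun w _ hw => ?_).symm
  by_contra hne
  exact hw (hs w hne)

theorem convex_geomRel_singleton (σ : Finset U) : Convex ℝ (geomRel {σ}) := by
  rintro f ⟨_, rfl, hf0, hfs, hf1⟩ g ⟨_, rfl, hg0, hgs, hg1⟩ a b ha hb hab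
  refine ⟨_, rfl, fun w => ?_, fun w hw => ?_, ?_⟩
  · have := hf0 w
    have := hg0 w
    simp only [Pi.add_apply, Pi.smul_apply, smul_eq_mul]
    positivity
  · by_contra hn
    have h1 : f w = 0 := by_contra fun h => hn (hfs w h)
    have h2 : g w = 0 := by_contra fun h => hn (hgs w h)
    simp [h1, h2] at hw
  · simp [Finset.sum_add_distrib, ← Finset.mul_sum, hf1, hg1, hab]

variable [Fintype U]

theorem mem_geomRel_singleton_of_sum_univ {σ : Finset U} {f : U → ℝ} (h0 : ∀ w, 0 ≤ f w)
    (hs : ∀ w, f w ≠ 0 → w ∈ σ) (h1 : ∑ w, f w = 1) : f ∈ geomRel {σ} := by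
  refine ⟨σ, rfl, h0, hs, ?_⟩
  rw [← h1]
  refine Finset.sum_subset (Finset.subset_univ _) fun w _ hw => ?_
  by_contra hne
  exact hw (hs w hne)

/-- Normalizing a nonzero nonnegative function yields a point of the simplex on its support. -/
theorem normalize_mem_geomRel {σ : Finset U} {f : U → ℝ} (h0 : ∀ w, 0 ≤ f w)
    (hs : ∀ w, f w ≠ 0 → w ∈ σ) (h1 : 0 < ∑ w, f w) : (∑ w, f w)⁻¹ • f ∈ geomRel {σ} := by
  refine mem_geomRel_singleton_of_sum_univ (fun w => ?_) (fun w hw => hs w fun h => ?_) ?_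
  · exact mul_nonneg (inv_nonneg.2 h1.le) (h0 w)
  · simp [h] at hw
  · simp [← Finset.mul_sum, h1.ne']

/-- The set of vertices at which a function exceeds `a`. -/
noncomputable def superlevel (a : ℝ) (f : U → ℝ) : Finset U :=
  {w | a < f w}

theorem mem_superlevel {a : ℝ} {f : U → ℝ} {w : U} : w ∈ superlevel a f ↔ a < f w := by
  simp [superlevel]

theorem superlevel_zero_subset {σ : Finset U} {f : U → ℝ} (hf : f ∈ geomRel {σ}) :
    superlevel 0 f ⊆ σ := by
  obtain ⟨_, rfl, -, hs, -⟩ := hf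
  exact fun w hw => hs w (mem_superlevel.1 hw).ne'

theorem sum_univ_of_mem_geomRel {Z : Set (Finset U)} {f : U → ℝ} (hf : f ∈ geomRel Z) :
    ∑ w, f w = 1 := by
  obtain ⟨σ, -, -, hs, h1⟩ := hf
  rw [← h1]
  refine (Finset.sum_subset (Finset.subset_univ _) fun w _ hw => ?_).symm
  by_contra hne
  exact hw (hs w hne)

theorem mem_geomRel_superlevel_zero {Z : Set (Finset U)} {f : U → ℝ} (hf : f ∈ geomRel Z) :
    f ∈ geomRel {superlevel 0 f} :=
  mem_geomRel_singleton_of_sum_univ (nonneg_of_mem_geomRel hf)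
    (fun w hw => mem_superlevel.2 ((nonneg_of_mem_geomRel hf w).lt_of_ne' hw))
    (sum_univ_of_mem_geomRel hf)

theorem mem_geomRel_iff_superlevel_mem {Z : Set (Finset U)} (hZ : IsComplex Z) {f : U → ℝ}
    (hf : f ∈ geomRel {superlevel 0 f}) : f ∈ geomRel Z ↔ superlevel 0 f ∈ Z := by
  refine ⟨fun h => ?_, fun h => mem_geomRel_iff.2 ⟨_, h, hf⟩⟩
  obtain ⟨σ, hσ, h⟩ := mem_geomRel_iff.1 h
  exact hZ σ hσ _ (superlevel_zero_subset h)

end GeometricRealization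

theorem orderComplex_mono {α : Type*} [Preorder α] {S T : Set α} (h : S ⊆ T) :
    orderComplex S ⊆ orderComplex T :=
  fun _ hC => ⟨hC.1.trans h, hC.2⟩

open Classical in
theorem starConvex_geomRel_orderComplex_Ici {P : Type*} [PartialOrder P] (κ : P) :
    StarConvex ℝ (Pi.single κ 1) (geomRel (orderComplex (Set.Ici κ))) := by
  rw [starConvex_iff_segment_subset]
  intro t ht
  obtain ⟨C, hC, ht⟩ := mem_geomRel_iff.1 ht
  have hC' : insert κ C ∈ orderComplex (Set.Ici κ) := by
    rw [orderComplex, Set.mem_ofPred_eq, Finset.coe_insert, Set.insert_subset_iff]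
    exact ⟨⟨le_rfl, hC.1⟩, hC.2.insert fun J hJ _ => Or.inl (hC.1 hJ)⟩
  have hκ : (Pi.single κ 1 : P → ℝ) ∈ geomRel {insert κ C} := by
    refine ⟨_, rfl, fun J => ?_, fun J hJ => ?_, ?_⟩
    · by_cases h : J = κ <;> simp [h]
    · by_cases h : J = κ
      · simp [h]
      · simp [h] at hJ
    · simp
  exact ((convex_geomRel_singleton _).segment_subset hκ
    (geomRel_singleton_mono (Finset.subset_insert _ _) ht)).trans
    (geomRel_mono (Set.singleton_subset_iff.2 hC'))

section Thickening

variable {W P : Type} [PartialOrder P] (Y : P → Set (Finset W))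

/-- The union `⋃_K |Y_K| × |Δ(P_{≥K})|` for a family of complexes indexed by a poset `P`. -/
def thickening : Set ((W → ℝ) × (P → ℝ)) :=
  ⋃ K, geomRel (Y K) ×ˢ geomRel (orderComplex (Set.Ici K))

variable {Y}

theorem prod_subset_thickening {K : P} {σ : Finset W} {C : Finset P} (hσ : σ ∈ Y K)
    (hC : C ∈ orderComplex (Set.Ici K)) : geomRel {σ} ×ˢ geomRel {C} ⊆ thickening Y :=
  (Set.prod_mono (geomRel_mono (Set.singleton_subset_iff.2 hσ))
    (geomRel_mono (Set.singleton_subset_iff.2 hC))).trans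
    (Set.subset_iUnion (fun K => geomRel (Y K) ×ˢ geomRel (orderComplex (Set.Ici K))) K)

theorem mem_geomRel_iUnion_of_mem_thickening {x : (W → ℝ) × (P → ℝ)} (hx : x ∈ thickening Y) :
    x.1 ∈ geomRel (⋃ K, Y K) := by
  obtain ⟨K, h1, -⟩ := Set.mem_iUnion.1 hx
  exact geomRel_mono (Set.subset_iUnion Y K) h1

variable (Y) in
/-- The projection of `⋃_K |Y_K| × |Δ(P_{≥K})|` onto the first coordinate. -/
def thickeningProj : C(thickening Y, geomRel (⋃ K, Y K)) where
  toFun x := ⟨x.1.1, mem_geomRel_iUnion_of_mem_thickening x.2⟩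
  continuous_toFun := by fun_prop

theorem preimage_thickeningProj (y : geomRel (⋃ K, Y K)) {κ : P}
    (hκ : IsLeast {K | (y : W → ℝ) ∈ geomRel (Y K)} κ) :
    thickeningProj Y ⁻¹' {y} =
      Subtype.val ⁻¹' ({(y : W → ℝ)} ×ˢ geomRel (orderComplex (Set.Ici κ))) := by
  ext ⟨⟨z, t⟩, hx⟩
  simp only [thickeningProj, ContinuousMap.coe_mk, Set.mem_preimage, Set.mem_singleton_iff,
    Subtype.ext_iff, Set.mem_prod]
  refine ⟨fun h => ⟨h, ?_⟩, fun h => h.1⟩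
  obtain ⟨K, h1, h2⟩ := Set.mem_iUnion.1 hx
  obtain rfl : z = y := h
  exact geomRel_mono (orderComplex_mono (Set.Ici_subset_Ici.2 (hκ.2 h1))) h2

theorem contractibleSpace_preimage_thickeningProj (y : geomRel (⋃ K, Y K)) {κ : P}
    (hκ : IsLeast {K | (y : W → ℝ) ∈ geomRel (Y K)} κ) :
    ContractibleSpace (thickeningProj Y ⁻¹' {y}) := by
  classical
  have hmem (x : thickening Y) : x ∈ thickeningProj Y ⁻¹' {y} ↔
      x.1.1 = (y : W → ℝ) ∧ x.1.2 ∈ geomRel (orderComplex (Set.Ici κ)) := by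
    rw [preimage_thickeningProj y hκ]
    rfl
  have hne : (geomRel (orderComplex (Set.Ici κ))).Nonempty := by
    refine ⟨Pi.single κ 1, {κ}, ⟨by simp, by simp⟩, fun J => ?_, fun J hJ => ?_, by simp⟩
    · by_cases h : J = κ <;> simp [h]
    · by_contra h
      simp_all
  have := (starConvex_geomRel_orderComplex_Ici κ).contractibleSpace hne
  let e : (thickeningProj Y ⁻¹' {y}) ≃ₜ geomRel (orderComplex (Set.Ici κ)) :=
    { toFun := fun x => ⟨x.1.1.2, ((hmem x.1).1 x.2).2⟩
      invFun := fun t => ⟨⟨(y, t), Set.mem_iUnion.2 ⟨κ, hκ.1, t.2⟩⟩, (hmem _).2 ⟨rfl, t.2⟩⟩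
      left_inv := fun x => Subtype.ext (Subtype.ext (Prod.ext ((hmem x.1).1 x.2).1.symm rfl))
      right_inv := fun t => rfl
      continuous_toFun := by fun_prop
      continuous_invFun := by fun_prop }
  exact e.contractibleSpace

variable [Fintype W]

theorem exists_of_mem_thickening {x : (W → ℝ) × (P → ℝ)} (hY : ∀ K, IsComplex (Y K))
    (hx : x ∈ thickening Y) :
    ∃ K, superlevel 0 x.1 ∈ Y K ∧ x.1 ∈ geomRel {superlevel 0 x.1} ∧
      ∃ C ∈ orderComplex (Set.Ici K), x.2 ∈ geomRel {C} := by
  obtain ⟨K, h1, h2⟩ := Set.mem_iUnion.1 hx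
  have h := mem_geomRel_superlevel_zero h1
  exact ⟨K, (mem_geomRel_iff_superlevel_mem (hY K) h).1 h1, h, mem_geomRel_iff.1 h2⟩

theorem exists_of_mem_geomRel_iUnion {ι : Type*} {Y : ι → Set (Finset W)} {y : W → ℝ}
    (hY : ∀ K, IsComplex (Y K))
    (hy : y ∈ geomRel (⋃ K, Y K)) :
    ∃ K, superlevel 0 y ∈ Y K ∧ y ∈ geomRel {superlevel 0 y} := by
  obtain ⟨σ, hσ, h⟩ := mem_geomRel_iff.1 hy
  obtain ⟨K, hK⟩ := Set.mem_iUnion.1 hσ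
  exact ⟨K, hY K σ hK _ (superlevel_zero_subset h), mem_geomRel_superlevel_zero hy⟩

variable (W) in
/-- A positive threshold that every point of a simplex with vertices in `W` exceeds at some
vertex. -/
noncomputable def threshold : ℝ :=
  ((Fintype.card W : ℝ) + 1)⁻¹

theorem threshold_pos : 0 < threshold W := by
  unfold threshold
  positivity

theorem exists_threshold_lt {y : W → ℝ} (hy : ∑ w, y w = 1) : ∃ w, threshold W < y w := by
  by_contra! h
  have h1 := Finset.sum_le_sum fun w (_ : w ∈ Finset.univ) => h w
  rw [hy, Finset.sum_const, Finset.card_univ, nsmul_eq_mul, threshold, ← div_eq_mul_inv,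
    one_le_div (by positivity)] at h1
  linarith

/-- The part of `y` above the threshold. -/
noncomputable def truncated (y : W → ℝ) (w : W) : ℝ :=
  max (y w - threshold W) 0

/-- The normalized part of `y` above the threshold. -/
noncomputable def retraction (y : W → ℝ) : W → ℝ :=
  (∑ w, truncated y w)⁻¹ • truncated y

theorem truncated_ne_zero {y : W → ℝ} {w : W} (h : truncated y w ≠ 0) : threshold W < y w := by
  by_contra hn
  exact h (max_eq_right (by linarith))

theorem sum_truncated_pos {y : W → ℝ} (hy : ∑ w, y w = 1) : 0 < ∑ w, truncated y w := by
  obtain ⟨w, hw⟩ := exists_threshold_lt hy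
  exact Finset.sum_pos' (fun _ _ => le_max_right _ _)
    ⟨w, Finset.mem_univ _, lt_max_of_lt_left (sub_pos.2 hw)⟩

theorem retraction_mem {y : W → ℝ} (hy : ∑ w, y w = 1) :
    retraction y ∈ geomRel {superlevel (threshold W) y} :=
  normalize_mem_geomRel (fun _ => le_max_right _ _)
    (fun _ hw => mem_superlevel.2 (truncated_ne_zero hw)) (sum_truncated_pos hy)

theorem superlevel_threshold_subset (y : W → ℝ) : superlevel (threshold W) y ⊆ superlevel 0 y :=
  fun _ hw => mem_superlevel.2 (threshold_pos.trans (mem_superlevel.1 hw))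

theorem retraction_mem_of_mem {y : W → ℝ} (hy : y ∈ geomRel {superlevel 0 y}) :
    retraction y ∈ geomRel {superlevel 0 y} :=
  geomRel_singleton_mono (superlevel_threshold_subset y)
    (retraction_mem (sum_univ_of_mem_geomRel hy))

open Classical in
/-- A continuous function of `y` that is nonzero precisely when `L` is a superlevel set of `y` at
a nonnegative level below the threshold. -/
noncomputable def levelWeight (y : W → ℝ) (L : Finset W) : ℝ :=
  (∏ w ∈ L, (max (y w) 0 * ∏ v with v ∉ L, max (y w - y v) 0)) *
    ∏ v with v ∉ L, max (threshold W - y v) 0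

theorem levelWeight_nonneg (y : W → ℝ) (L : Finset W) : 0 ≤ levelWeight y L := by
  unfold levelWeight
  positivity

theorem continuous_levelWeight (L : Finset W) : Continuous fun y : W → ℝ => levelWeight y L := by
  unfold levelWeight
  fun_prop

theorem levelWeight_ne_zero {y : W → ℝ} {L : Finset W} (h : levelWeight y L ≠ 0) :
    (∀ w ∈ L, 0 < y w) ∧ (∀ w ∈ L, ∀ v ∉ L, y v < y w) ∧ ∀ v ∉ L, y v < threshold W := by
  have hmax {r : ℝ} (hr : max r 0 ≠ 0) : 0 < r := by
    by_contra hn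
    exact hr (max_eq_right (not_lt.1 hn))
  simp only [levelWeight, mul_ne_zero_iff, Finset.prod_ne_zero_iff, Finset.mem_filter,
    Finset.mem_univ, true_and] at h
  exact ⟨fun w hw => hmax (h.1 w hw).1, fun w hw v hv => sub_pos.1 (hmax ((h.1 w hw).2 v hv)),
    fun v hv => sub_pos.1 (hmax (h.2 v hv))⟩

theorem levelWeight_superlevel_zero_ne_zero (y : W → ℝ) : levelWeight y (superlevel 0 y) ≠ 0 := by
  simp only [levelWeight, mul_ne_zero_iff, Finset.prod_ne_zero_iff, Finset.mem_filter,
    Finset.mem_univ, true_and, mem_superlevel, not_lt]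
  have := threshold_pos (W := W)
  exact ⟨fun w hw => ⟨(lt_max_of_lt_left hw).ne', fun v hv =>
    (lt_max_of_lt_left (by linarith)).ne'⟩, fun v hv => (lt_max_of_lt_left (by linarith)).ne'⟩

theorem subset_superlevel_zero_of_levelWeight_ne_zero {y : W → ℝ} {L : Finset W}
    (h : levelWeight y L ≠ 0) : L ⊆ superlevel 0 y :=
  fun w hw => mem_superlevel.2 ((levelWeight_ne_zero h).1 w hw)

theorem superlevel_threshold_subset_of_levelWeight_ne_zero {y : W → ℝ} {L : Finset W}
    (h : levelWeight y L ≠ 0) : superlevel (threshold W) y ⊆ L := by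
  intro w hw
  by_contra hn
  exact lt_asymm (mem_superlevel.1 hw) ((levelWeight_ne_zero h).2.2 w hn)

theorem subset_or_subset_of_levelWeight_ne_zero {y : W → ℝ} {L L' : Finset W}
    (h : levelWeight y L ≠ 0) (h' : levelWeight y L' ≠ 0) : L ⊆ L' ∨ L' ⊆ L := by
  by_contra! hn
  obtain ⟨w, hw, hw'⟩ := Finset.not_subset.1 hn.1
  obtain ⟨v, hv, hv'⟩ := Finset.not_subset.1 hn.2
  exact lt_asymm ((levelWeight_ne_zero h).2.1 w hw v hv') ((levelWeight_ne_zero h').2.1 v hv w hw')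

theorem segment_retraction_subset (hY : ∀ K, IsComplex (Y K)) {x : (W → ℝ) × (P → ℝ)}
    (hx : x ∈ thickening Y) : segment ℝ (retraction x.1, x.2) x ⊆ thickening Y := by
  obtain ⟨K, hK, hy, C, hC, ht⟩ := exists_of_mem_thickening hY hx
  exact (((convex_geomRel_singleton _).prod (convex_geomRel_singleton _)).segment_subset
    (Set.mk_mem_prod (retraction_mem_of_mem hy) ht) ⟨hy, ht⟩).trans (prod_subset_thickening hK hC)

variable (Y)

open Classical in
/-- The total weight of the superlevel sets of `y` for which `J` is the least index of a member of
the family containing them. -/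
noncomputable def indexWeight (y : W → ℝ) (J : P) : ℝ :=
  ∑ L with IsLeast {K | L ∈ Y K} J, levelWeight y L

theorem continuous_indexWeight (J : P) : Continuous fun y : W → ℝ => indexWeight Y y J :=
  continuous_finsetSum _ fun L _ => continuous_levelWeight L

theorem indexWeight_nonneg (y : W → ℝ) (J : P) : 0 ≤ indexWeight Y y J :=
  Finset.sum_nonneg fun L _ => levelWeight_nonneg y L

variable [Fintype P]

/-- The point of `|Δ(P)|` obtained by normalizing `indexWeight`. -/
noncomputable def indexPoint (y : W → ℝ) : P → ℝ :=
  (∑ J, indexWeight Y y J)⁻¹ • indexWeight Y y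

open Classical in
/-- The set of indices of nonzero weight. -/
noncomputable def indexChain (y : W → ℝ) : Finset P :=
  {J | indexWeight Y y J ≠ 0}

variable {Y}

theorem exists_of_mem_indexChain {y : W → ℝ} {J : P} (h : J ∈ indexChain Y y) :
    ∃ L, IsLeast {K | L ∈ Y K} J ∧ levelWeight y L ≠ 0 := by
  classical
  obtain ⟨L, hL, hw⟩ := Finset.exists_ne_zero_of_sum_ne_zero (Finset.mem_filter.1 h).2
  exact ⟨L, (Finset.mem_filter.1 hL).2, hw⟩

theorem sum_indexWeight_pos {y : W → ℝ} {κ : P} (hκ : IsLeast {K | superlevel 0 y ∈ Y K} κ) :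
    0 < ∑ J, indexWeight Y y J := by
  classical
  refine Finset.sum_pos' (fun J _ => indexWeight_nonneg Y y J) ⟨κ, Finset.mem_univ _, ?_⟩
  exact Finset.sum_pos' (fun L _ => levelWeight_nonneg y L) ⟨superlevel 0 y, by simpa using hκ,
    (levelWeight_nonneg y _).lt_of_ne' (levelWeight_superlevel_zero_ne_zero y)⟩

theorem indexPoint_mem {y : W → ℝ} {κ : P} (hκ : IsLeast {K | superlevel 0 y ∈ Y K} κ) :
    indexPoint Y y ∈ geomRel {indexChain Y y} :=
  normalize_mem_geomRel (indexWeight_nonneg Y y) (fun J hJ => by simpa [indexChain] using hJ)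
    (sum_indexWeight_pos hκ)

theorem isChain_indexChain (hY : ∀ K, IsComplex (Y K)) (y : W → ℝ) :
    IsChain (· ≤ ·) (indexChain Y y : Set P) := by
  intro J hJ J' hJ' _
  obtain ⟨L, hL, hw⟩ := exists_of_mem_indexChain hJ
  obtain ⟨L', hL', hw'⟩ := exists_of_mem_indexChain hJ'
  rcases subset_or_subset_of_levelWeight_ne_zero hw hw' with h | h
  · exact Or.inl (hL.2 (hY J' L' hL'.1 L h))
  · exact Or.inr (hL'.2 (hY J L hL.1 L' h))

theorem le_of_mem_indexChain {y : W → ℝ} {J K : P} (hY : ∀ K, IsComplex (Y K))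
    (hJ : J ∈ indexChain Y y)
    (hK : superlevel 0 y ∈ Y K) : J ≤ K := by
  obtain ⟨L, hL, hw⟩ := exists_of_mem_indexChain hJ
  exact hL.2 (hY K _ hK L (subset_superlevel_zero_of_levelWeight_ne_zero hw))

theorem le_indexChain (hY : ∀ K, IsComplex (Y K)) {y : W → ℝ} {J κ : P}
    (hκ : IsLeast {K | superlevel (threshold W) y ∈ Y K} κ) (hJ : J ∈ indexChain Y y) : κ ≤ J := by
  obtain ⟨L, hL, hw⟩ := exists_of_mem_indexChain hJ
  exact hκ.2 (hY J L hL.1 _ (superlevel_threshold_subset_of_levelWeight_ne_zero hw))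

theorem indexChain_mem (hY : ∀ K, IsComplex (Y K)) {y : W → ℝ} {κ : P}
    (hκ : IsLeast {K | superlevel (threshold W) y ∈ Y K} κ) :
    indexChain Y y ∈ orderComplex (Set.Ici κ) :=
  ⟨fun _ hJ => le_indexChain hY hκ hJ, isChain_indexChain hY y⟩

theorem retraction_indexPoint_mem (hY : ∀ K, IsComplex (Y K))
    (hleast : ∀ σ K, σ ∈ Y K → ∃ κ, IsLeast {K | σ ∈ Y K} κ) {y : W → ℝ}
    (hy : y ∈ geomRel (⋃ K, Y K)) : (retraction y, indexPoint Y y) ∈ thickening Y := by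
  obtain ⟨K, hK, hy'⟩ := exists_of_mem_geomRel_iUnion hY hy
  obtain ⟨κ, hκ⟩ := hleast _ K hK
  obtain ⟨κ', hκ'⟩ := hleast _ K (hY K _ hK _ (superlevel_threshold_subset y))
  exact prod_subset_thickening (Y := Y) hκ'.1 (indexChain_mem hY hκ')
    (Set.mk_mem_prod (retraction_mem (sum_univ_of_mem_geomRel hy)) (indexPoint_mem hκ))

theorem segment_indexPoint_subset (hY : ∀ K, IsComplex (Y K))
    (hleast : ∀ σ K, σ ∈ Y K → ∃ κ, IsLeast {K | σ ∈ Y K} κ) {x : (W → ℝ) × (P → ℝ)}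
    (hx : x ∈ thickening Y) :
    segment ℝ (retraction x.1, indexPoint Y x.1) (retraction x.1, x.2) ⊆ thickening Y := by
  classical
  obtain ⟨K, hK, hy, C, hC, ht⟩ := exists_of_mem_thickening hY hx
  obtain ⟨κ, hκ⟩ := hleast _ K hK
  have hK' : superlevel (threshold W) x.1 ∈ Y K := hY K _ hK _ (superlevel_threshold_subset x.1)
  obtain ⟨κ', hκ'⟩ := hleast _ K hK'
  have hmem := indexChain_mem hY hκ'
  have hunion : indexChain Y x.1 ∪ C ∈ orderComplex (Set.Ici κ') := by
    refine ⟨?_, ?_⟩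
    · rw [Finset.coe_union]
      exact Set.union_subset hmem.1 (hC.1.trans (Set.Ici_subset_Ici.2 (hκ'.2 hK')))
    · rw [Finset.coe_union]
      exact isChain_union.2 ⟨hmem.2, hC.2, fun J hJ J' hJ' _ =>
        Or.inl ((le_of_mem_indexChain hY hJ hK).trans (hC.1 hJ'))⟩
  have hr := retraction_mem (sum_univ_of_mem_geomRel hy)
  exact (((convex_geomRel_singleton _).prod (convex_geomRel_singleton _)).segment_subset
    (Set.mk_mem_prod hr (geomRel_singleton_mono Finset.subset_union_left (indexPoint_mem hκ)))
    (Set.mk_mem_prod hr (geomRel_singleton_mono Finset.subset_union_right ht))).trans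
    (prod_subset_thickening hκ'.1 hunion)

theorem continuous_retraction {X : Type*} [TopologicalSpace X] {f : X → W → ℝ} (hf : Continuous f)
    (h : ∀ x, ∑ w, f x w = 1) : Continuous fun x => retraction (f x) := by
  have ht : Continuous fun x => truncated (f x) := by
    unfold truncated
    fun_prop
  exact ((continuous_finsetSum _ fun w _ => (continuous_apply w).comp ht).inv₀
    fun x => (sum_truncated_pos (h x)).ne').smul ht

theorem continuous_indexPoint {X : Type*} [TopologicalSpace X] {f : X → W → ℝ} (hf : Continuous f)
    (h : ∀ x, ∃ κ, IsLeast {K | superlevel 0 (f x) ∈ Y K} κ) :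
    Continuous fun x => indexPoint Y (f x) := by
  have hw (J : P) : Continuous fun x => indexWeight Y (f x) J :=
    (continuous_indexWeight Y J).comp hf
  refine ((continuous_finsetSum _ fun J _ => hw J).inv₀ fun x => ?_).smul (continuous_pi hw)
  obtain ⟨κ, hκ⟩ := h x
  exact (sum_indexWeight_pos hκ).ne'

/-- If every simplex of the family lies in a least member, then the projection
`⋃_K |Y_K| × |Δ(P_{≥K})| → |⋃_K Y_K|` is a homotopy equivalence. -/
theorem exists_homotopyEquiv_thickeningProj (hY : ∀ K, IsComplex (Y K))
    (hleast : ∀ σ K, σ ∈ Y K → ∃ κ, IsLeast {K | σ ∈ Y K} κ) :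
    ∃ E : ContinuousMap.HomotopyEquiv (thickening Y) (geomRel (⋃ K, Y K)),
      E.toFun = thickeningProj Y := by
  let s : C(geomRel (⋃ K, Y K), thickening Y) :=
    ⟨fun y => ⟨(retraction y.1, indexPoint Y y.1), retraction_indexPoint_mem hY hleast y.2⟩,
      Continuous.subtype_mk ((continuous_retraction continuous_subtype_val
        fun y => sum_univ_of_mem_geomRel y.2).prodMk (continuous_indexPoint continuous_subtype_val
        fun y => by
          obtain ⟨K, hK, -⟩ := exists_of_mem_geomRel_iUnion hY y.2
          exact hleast _ K hK)) _⟩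
  let r : C(thickening Y, thickening Y) :=
    ⟨fun x => ⟨(retraction x.1.1, x.1.2),
        segment_retraction_subset hY x.2 (left_mem_segment _ _ _)⟩,
      Continuous.subtype_mk ((continuous_retraction (continuous_fst.comp continuous_subtype_val)
        fun x => sum_univ_of_mem_geomRel (mem_geomRel_iUnion_of_mem_thickening x.2)).prodMk
        (continuous_snd.comp continuous_subtype_val)) _⟩
  refine ⟨⟨thickeningProj Y, s, ?_, ?_⟩, rfl⟩
  · exact (homotopic_of_segment_subset (s.comp (thickeningProj Y)) r
      fun x => segment_indexPoint_subset hY hleast x.2).trans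
      (homotopic_of_segment_subset r (ContinuousMap.id _) fun x => segment_retraction_subset hY x.2)
  · refine homotopic_of_segment_subset _ _ fun y => ?_
    obtain ⟨K, hK, hy⟩ := exists_of_mem_geomRel_iUnion hY y.2
    exact ((convex_geomRel_singleton _).segment_subset (retraction_mem_of_mem hy) hy).trans
      (geomRel_mono (Set.singleton_subset_iff.2 (Set.mem_iUnion.2 ⟨K, hK⟩)))

end Thickening

section ProperFlats

variable {V W : Type} {M : Matroid V}

theorem inter_mem_properFlats {K K' : Set V} (hK : K ∈ ProperFlats M) (hK' : K' ∈ ProperFlats M) :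
    K ∩ K' ∈ ProperFlats M :=
  ⟨Set.inter_eq_iInter ▸ Matroid.IsFlat.iInter (Bool.forall_bool.2 ⟨hK'.1, hK.1⟩),
    fun h => hK.2 (hK.1.subset_ground.antisymm (h ▸ Set.inter_subset_left))⟩

theorem filtUnion_zero_eq_thickening (Y : ProperFlats M → Set (Finset W)) :
    FiltUnion M Y 0 = thickening Y := by
  ext x
  simp only [FiltUnion, thickening, Set.mem_iUnion]
  exact ⟨fun ⟨K, hK⟩ => ⟨K.1, hK⟩, fun ⟨K, hK⟩ => ⟨⟨K, Nat.zero_le _⟩, hK⟩⟩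

theorem exists_isLeast_properFlats [Finite V] {Y : ProperFlats M → Set (Finset W)}
    (hYinter : ∀ (K K' : ProperFlats M) (h : (K : Set V) ∩ (K' : Set V) ∈ ProperFlats M),
      Y K ∩ Y K' = Y ⟨(K : Set V) ∩ (K' : Set V), h⟩)
    (σ : Finset W) (K : ProperFlats M) (hK : σ ∈ Y K) : ∃ κ, IsLeast {K | σ ∈ Y K} κ := by
  obtain ⟨κ, hκ⟩ := (Set.toFinite {K | σ ∈ Y K}).exists_minimal ⟨K, hK⟩
  refine ⟨κ, hκ.1, fun J hJ => ?_⟩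
  have h := inter_mem_properFlats κ.2 J.2
  have hmem : σ ∈ Y ⟨_, h⟩ := hYinter κ J h ▸ ⟨hκ.1, hJ⟩
  have hle : κ ≤ ⟨_, h⟩ := hκ.2 hmem (Subtype.coe_le_coe.1 Set.inter_subset_left)
  exact hle.trans (Subtype.coe_le_coe.1 Set.inter_subset_right)

theorem IsLeast.setOf_biInter_subset_eq_Ici {S : Set (ProperFlats M)} {κ : ProperFlats M}
    (hκ : IsLeast S κ) :
    {J : ProperFlats M | (⋂ K ∈ S, (K : Set V)) ⊆ (J : Set V)} = Set.Ici κ := by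
  have h : ⋂ K ∈ S, (K : Set V) = κ :=
    (Set.biInter_subset_of_mem hκ.1).antisymm (Set.subset_iInter₂ fun K hK => hκ.2 hK)
  rw [h]
  rfl

end ProperFlats

/-- **The Vietoris–Begle step in Proposition 3.1.**
For a matroid `M` of rank `m ≥ 1` on `V` and complexes `{Y_K : K ∈ K(M)}` with
`Y_K ∩ Y_{K'} = Y_{K∩K'}`, the projection `φ : F_{m-1} → |Y|` onto the first coordinate
(where `Y = ⋃_K Y_K` and `F_{m-1} = ⋃_{K ∈ K(M)} |Y_K| × |Δ(K(M)_{≥K})|`) has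
contractible fibers `φ⁻¹(y) = {y} × |Δ(K(M)_{≥ K_y})|` with
`K_y = ⋂ {K ∈ K(M) : y ∈ |Y_K|}`, and `φ` induces an isomorphism
`H_*(F_{m-1}; F) ≅ H_*(Y; F)`. -/
theorem projection_contractible_fibers_homology_iso
    {V : Type} [Fintype V] {W : Type} [Fintype W] (F : Type) [Field F]
    (M : Matroid V) (hME : M.E = Set.univ)
    (m : ℕ) (hm : matroidRank M Set.univ = m) (hm1 : 1 ≤ m)
    (Y : ProperFlats M → Set (Finset W))
    (hYcx : ∀ K, IsComplex (Y K))
    (hYinter : ∀ (K K' : ProperFlats M) (h : (K : Set V) ∩ (K' : Set V) ∈ ProperFlats M),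
      Y K ∩ Y K' = Y ⟨(K : Set V) ∩ (K' : Set V), h⟩) :
    ∃ φ : C(↥(FiltUnion M Y 0), ↥(geomRel (⋃ K, Y K))),
      (∀ x : ↥(FiltUnion M Y 0),
        ((φ x : ↥(geomRel (⋃ K, Y K))) : W → ℝ) =
          ((x : ↥(FiltUnion M Y 0)) : (W → ℝ) × (↥(ProperFlats M) → ℝ)).1) ∧
      (∀ y : ↥(geomRel (⋃ K, Y K)),
        φ ⁻¹' {y} = Subtype.val ⁻¹'
            ({((y : ↥(geomRel (⋃ K, Y K))) : W → ℝ)} ×ˢ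
              geomRel (orderComplex {J : ↥(ProperFlats M) |
                (⋂ K ∈ {K : ↥(ProperFlats M) |
                    ((y : ↥(geomRel (⋃ K', Y K'))) : W → ℝ) ∈ geomRel (Y K)},
                  (K : Set V)) ⊆ (J : Set V)})) ∧
          ContractibleSpace ↥(φ ⁻¹' {y})) ∧
      (∀ n : ℕ,
        ∃ e : SingH F ↥(FiltUnion M Y 0) n ≃ₗ[F] SingH F ↥(geomRel (⋃ K, Y K)) n,
          ∀ (c : SingChain F ↥(FiltUnion M Y 0) n)
            (hc : c ∈ singCyc F ↥(FiltUnion M Y 0) n),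
            ∃ hc' : pushf F φ n c ∈ singCyc F ↥(geomRel (⋃ K, Y K)) n,
              e (Submodule.Quotient.mk ⟨c, hc⟩) =
                Submodule.Quotient.mk ⟨pushf F φ n c, hc'⟩) := by
  have : Fintype (ProperFlats M) := Fintype.ofFinite _
  have hleast := exists_isLeast_properFlats hYinter
  rw [filtUnion_zero_eq_thickening]
  refine ⟨thickeningProj Y, fun _ => rfl, fun y => ?_, fun n => ?_⟩
  · obtain ⟨K, hK, hy⟩ := exists_of_mem_geomRel_iUnion hYcx y.2
    obtain ⟨κ, hκ⟩ := hleast _ K hK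
    have hκ' : IsLeast {K | (y : W → ℝ) ∈ geomRel (Y K)} κ := by
      simpa only [mem_geomRel_iff_superlevel_mem (hYcx _) hy] using hκ
    rw [hκ'.setOf_biInter_subset_eq_Ici]
    exact ⟨preimage_thickeningProj y hκ', contractibleSpace_preimage_thickeningProj y hκ'⟩
  · obtain ⟨E, hE⟩ := exists_homotopyEquiv_thickeningProj hYcx hleast
    rw [← hE]
    exact E.exists_singH_equiv F n
end
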